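/- arXiv:1902.06607 — 2 statements merged into one kernel-verified Lean document; each statement's English description precedes it below -/
import Mathlib

section
/- Let Q be a skew polynomial ring and f₁,…,f_c a regular sequence of homogeneous normal elements of Q. Then the skew Koszul complex K^Q(f₁,…,f_c) is a free resolution of Q/(f₁,…,f_c) over Q, i.e. H_i(K^Q(f)) = 0 for i > 0 and H_0(K^Q(f)) = Q/(f₁,…,f_c). -/
noncomputable section

/-- The skew-commutation relations defining the skew polynomial ring. -/
def skewRel (k : Type*) [Field k] {n : ℕ} (q : Fin n → Fin n → kˣ) :
    FreeAlgebra k (Fin n) → FreeAlgebra k (Fin n) → Prop :=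
  fun a b => ∃ i j : Fin n, a = FreeAlgebra.ι k i * FreeAlgebra.ι k j ∧
    b = (q i j : k) • (FreeAlgebra.ι k j * FreeAlgebra.ι k i)

/-- The skew polynomial ring `k_q[x₁,…,xₙ]`. -/
abbrev SkewPoly (k : Type*) [Field k] {n : ℕ} (q : Fin n → Fin n → kˣ) : Type _ :=
  RingQuot (skewRel k q)

/-- The variables `x i` of the skew polynomial ring. -/
def skewVar (k : Type*) [Field k] {n : ℕ} (q : Fin n → Fin n → kˣ) (i : Fin n) :
    SkewPoly k q :=
  RingQuot.mkAlgHom k (skewRel k q) (FreeAlgebra.ι k i)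

/-- The span of the words of length `d` in the variables: the homogeneous component of
internal degree `d` of the skew polynomial ring (deg xᵢ = 1). -/
def wordSpan (k : Type*) [Field k] {n : ℕ} (q : Fin n → Fin n → kˣ) (d : ℕ) :
    Submodule k (SkewPoly k q) :=
  Submodule.span k
    {m : SkewPoly k q | ∃ w : List (Fin n), w.length = d ∧ m = (w.map (skewVar k q)).prod}
namespace SkewKos
open Finsupp

section abs
variable {k Q : Type*} [Field k] [Ring Q] [Algebra k Q] {c : ℕ}

/-- subsets of the first `m` indices -/
def PS (c m : ℕ) : Set (Finset (Fin c)) := {T | ∀ s ∈ T, s.val < m}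

def MM (Q : Type*) [Ring Q] (c m : ℕ) : Submodule Q (Finset (Fin c) →₀ Q) :=
  Finsupp.supported Q Q (PS c m)

def II (f : Fin c → Q) (m : ℕ) : Ideal Q := Ideal.span {y | ∃ j : Fin c, j.val < m ∧ y = f j}

def ee (r : Fin c → Fin c → kˣ) (S : Finset (Fin c)) (j : Fin c) : k :=
  (-1) ^ ((S.filter (fun s => s < j)).card) * ∏ s ∈ S.filter (fun s => s < j), (r s j : k)

def AA (Q : Type*) [Ring Q] (m : Fin c) : (Finset (Fin c) →₀ Q) →ₗ[Q] (Finset (Fin c) →₀ Q) :=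
  Finsupp.linearCombination Q (fun T => single (insert m T) (1 : Q))

def BB (Q : Type*) [Ring Q] (m : Fin c) : (Finset (Fin c) →₀ Q) →ₗ[Q] (Finset (Fin c) →₀ Q) :=
  Finsupp.linearCombination Q (fun T => if m ∈ T then single (T.erase m) (1 : Q) else 0)

def FF (f : Fin c → Q) (r : Fin c → Fin c → kˣ) (m : Fin c) :
    (Finset (Fin c) →₀ Q) →ₗ[Q] (Finset (Fin c) →₀ Q) :=
  Finsupp.linearCombination Q (fun T => single T (ee r T m • f m))

lemma AA_single (m : Fin c) (T) (a : Q) : AA Q m (single T a) = single (insert m T) a := by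
  simp [AA, linearCombination_single]

lemma FF_single (f : Fin c → Q) (r : Fin c → Fin c → kˣ) (m : Fin c) (T) (a : Q) :
    FF f r m (single T a) = single T (ee r T m • (a * f m)) := by
  simp [FF, linearCombination_single]

lemma MM_eq (m : ℕ) : MM Q c m = Submodule.span Q ((fun T => single T (1 : Q)) '' PS c m) :=
  Finsupp.supported_eq_span_single Q _

lemma eqOn_MM {N : Type*} [AddCommGroup N] [Module Q N] {m : ℕ}
    {g h : (Finset (Fin c) →₀ Q) →ₗ[Q] N}
    (H : ∀ T ∈ PS c m, g (single T 1) = h (single T 1)) {x} (hx : x ∈ MM Q c m) : g x = h x := by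
  rw [MM_eq] at hx
  refine LinearMap.eqOn_span ?_ hx
  rintro _ ⟨T, hT, rfl⟩
  exact H T hT

lemma maps_MM {N : Type*} [AddCommGroup N] [Module Q N] {m : ℕ} {P : Submodule Q N}
    {g : (Finset (Fin c) →₀ Q) →ₗ[Q] N}
    (H : ∀ T ∈ PS c m, g (single T 1) ∈ P) {x} (hx : x ∈ MM Q c m) : g x ∈ P := by
  rw [MM_eq] at hx
  have : Submodule.span Q ((fun T => single T (1 : Q)) '' PS c m) ≤ P.comap g := by
    rw [Submodule.span_le]
    rintro _ ⟨T, hT, rfl⟩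
    exact H T hT
  exact this hx

lemma single_mem_MM {m : ℕ} {T : Finset (Fin c)} (hT : T ∈ PS c m) (a : Q) :
    single T a ∈ MM Q c m := Finsupp.single_mem_supported Q a hT

lemma PS_not_mem {m : Fin c} {T : Finset (Fin c)} (hT : T ∈ PS c m.val) : m ∉ T :=
  fun h => lt_irrefl _ (hT m h)

lemma PS_mono {m : ℕ} {T : Finset (Fin c)} (hT : T ∈ PS c m) : T ∈ PS c (m+1) :=
  fun s hs => Nat.lt_succ_of_lt (hT s hs)

lemma PS_insert {m : Fin c} {T : Finset (Fin c)} (hT : T ∈ PS c m.val) :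
    insert m T ∈ PS c (m.val+1) := by
  intro s hs
  rcases Finset.mem_insert.1 hs with rfl | h
  · exact Nat.lt_succ_self _
  · exact PS_mono hT s h

lemma PS_erase {m : ℕ} {j : Fin c} {T : Finset (Fin c)} (hT : T ∈ PS c m) :
    T.erase j ∈ PS c m := fun s hs => hT s (Finset.mem_of_mem_erase hs)

lemma MM_mono {m : ℕ} {x} (hx : x ∈ MM Q c m) : x ∈ MM Q c (m+1) :=
  Finsupp.supported_mono (fun _ h => PS_mono h) hx

lemma AA_mem {m : Fin c} {x} (hx : x ∈ MM Q c m.val) : AA Q m x ∈ MM Q c (m.val+1) :=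
  maps_MM (fun T hT => by rw [AA_single]; exact single_mem_MM (PS_insert hT) _) hx

lemma BB_MM {m : Fin c} {x} (hx : x ∈ MM Q c m.val) : BB Q m x = 0 := by
  refine eqOn_MM (h := 0) (fun T hT => ?_) hx
  simp [BB, linearCombination_single, PS_not_mem hT]

lemma BB_AA {m : Fin c} {x} (hx : x ∈ MM Q c m.val) : BB Q m (AA Q m x) = x := by
  refine eqOn_MM (g := BB Q m ∘ₗ AA Q m) (h := LinearMap.id) (fun T hT => ?_) hx
  simp [AA_single]
  simp [BB, linearCombination_single, Finset.erase_insert (PS_not_mem hT)]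

lemma decomp {m : Fin c} {x} (hx : x ∈ MM Q c (m.val+1)) :
    ∃ u ∈ MM Q c m.val, ∃ v ∈ MM Q c m.val, x = u + AA Q m v := by
  have : x ∈ MM Q c m.val ⊔ (MM Q c m.val).map (AA Q m) := by
    refine maps_MM (g := LinearMap.id) (fun T hT => ?_) hx
    by_cases hm : m ∈ T
    · refine Submodule.mem_sup_right ⟨single (T.erase m) 1, single_mem_MM ?_ _, ?_⟩
      · intro s hs
        have h1 := hT s (Finset.mem_of_mem_erase hs)
        have h2 : s.val ≠ m.val := fun h => Finset.ne_of_mem_erase hs (Fin.ext h)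
        omega
      · simp [AA_single, Finset.insert_erase hm]
    · refine Submodule.mem_sup_left (single_mem_MM ?_ _)
      intro s hs
      have h1 := hT s hs
      have h2 : s.val ≠ m.val := fun h => hm (Fin.ext h ▸ hs)
      omega
  obtain ⟨u, hu, _, ⟨v, hv, rfl⟩, rfl⟩ := Submodule.mem_sup.1 this
  exact ⟨u, hu, v, hv, rfl⟩

variable (f : Fin c → Q) (r : Fin c → Fin c → kˣ)
    (d : (Finset (Fin c) →₀ Q) →ₗ[Q] (Finset (Fin c) →₀ Q))

def IsD : Prop := ∀ S, d (single S 1) = ∑ j ∈ S, single (S.erase j) (ee r S j • f j)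

variable {f r d}

lemma d_mem (hd : IsD f r d) {m : ℕ} {x} (hx : x ∈ MM Q c m) : d x ∈ MM Q c m := by
  refine maps_MM (fun T hT => ?_) hx
  rw [hd]
  exact Submodule.sum_mem _ fun j _ => single_mem_MM (PS_erase hT) _

lemma filt_eq {m : Fin c} {T : Finset (Fin c)} (hT : T ∈ PS c m.val) :
    T.filter (fun s => s < m) = T :=
  Finset.filter_true_of_mem fun s hs => hT s hs

lemma ee_insert {m j : Fin c} {T : Finset (Fin c)} (hj : j < m) :
    ee r (insert m T) j = ee r T j := by
  unfold ee
  rw [Finset.filter_insert, if_neg (not_lt.2 hj.le)]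

lemma ee_insert_self {m : Fin c} {T : Finset (Fin c)} :
    ee r (insert m T) m = ee r T m := by
  unfold ee
  rw [Finset.filter_insert, if_neg (lt_irrefl _)]

lemma ee_erase {m j : Fin c} {T : Finset (Fin c)} (hT : T ∈ PS c m.val) (hj : j ∈ T) :
    ee r T m = - (ee r (T.erase j) m * r j m) := by
  unfold ee
  rw [filt_eq hT, filt_eq (PS_erase hT), ← Finset.prod_erase_mul _ _ hj,
    ← Finset.card_erase_add_one hj]
  ring

lemma d_single (hd : IsD f r d) (S : Finset (Fin c)) (a : Q) :
    d (single S a) = ∑ j ∈ S, single (S.erase j) (ee r S j • (a * f j)) := by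
  have : single S a = a • single S (1 : Q) := by simp
  rw [this, map_smul, hd, Finset.smul_sum]
  simp

lemma d_AA (hd : IsD f r d) {m : Fin c} {x} (hx : x ∈ MM Q c m.val) :
    d (AA Q m x) = AA Q m (d x) + FF f r m x := by
  refine eqOn_MM (g := d ∘ₗ AA Q m) (h := AA Q m ∘ₗ d + FF f r m) (fun T hT => ?_) hx
  have hm := PS_not_mem hT
  simp only [LinearMap.comp_apply, LinearMap.add_apply, AA_single, hd _, FF_single, map_sum]
  rw [Finset.sum_insert hm, Finset.erase_insert hm, ee_insert_self, one_mul, add_comm]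
  congr 1
  refine Finset.sum_congr rfl fun j hj => ?_
  have hjm : j < m := hT j hj
  rw [ee_insert hjm, Finset.erase_insert_of_ne hjm.ne']

lemma d_FF (hd : IsD f r d) (hskew : ∀ i j : Fin c, f i * f j = (r i j : k) • (f j * f i))
    {m : Fin c} {x} (hx : x ∈ MM Q c m.val) :
    d (FF f r m x) = - FF f r m (d x) := by
  refine eqOn_MM (g := d ∘ₗ FF f r m) (h := - (FF f r m ∘ₗ d)) (fun T hT => ?_) hx
  simp only [LinearMap.comp_apply, LinearMap.neg_apply, hd _, FF_single, map_sum, d_single hd]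
  rw [← Finset.sum_neg_distrib]
  refine Finset.sum_congr rfl fun j hj => ?_
  rw [← Finsupp.single_neg]
  congr 1
  rw [ee_erase hT hj, one_mul, smul_mul_assoc, smul_mul_assoc, hskew j m, smul_smul, smul_smul,
    smul_smul, ← neg_smul]
  congr 1
  ring

lemma d_d (hd : IsD f r d) (hskew : ∀ i j : Fin c, f i * f j = (r i j : k) • (f j * f i))
    (m : ℕ) (hm : m ≤ c) : ∀ x ∈ MM Q c m, d (d x) = 0 := by
  induction m with
  | zero =>
    intro x hx
    refine eqOn_MM (g := d ∘ₗ d) (h := 0) (fun T hT => ?_) hx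
    have : T = ∅ := Finset.eq_empty_of_forall_notMem fun s hs => absurd (hT s hs) (by omega)
    subst this
    simp [hd _]
  | succ m ih =>
    intro x hx
    obtain ⟨u, hu, v, hv, rfl⟩ := decomp (m := ⟨m, hm⟩) hx
    have ih' := ih (by omega)
    rw [map_add, map_add, ih' u hu, d_AA hd hv, map_add, d_AA hd (d_mem hd hv), ih' v hv,
      d_FF hd hskew hv]
    simp

lemma coef_d (hd : IsD f r d) {m : ℕ} {x} (hx : x ∈ MM Q c m) : d x ∅ ∈ II f m := by
  refine maps_MM (g := lapply ∅ ∘ₗ d) (P := II f m) (fun T hT => ?_) hx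
  simp only [LinearMap.comp_apply, hd _, lapply_apply, Finsupp.finsetSum_apply]
  refine Submodule.sum_mem _ fun j hj => ?_
  rw [single_apply]
  split_ifs
  · rw [Algebra.smul_def]
    exact Ideal.mul_mem_left _ _ (Ideal.subset_span ⟨j, hT j hj, rfl⟩)
  · exact zero_mem _

lemma coef_FF {m : Fin c} (x) : FF f r m x ∅ = x ∅ * f m := by
  induction x using Finsupp.induction_linear with
  | zero => simp
  | add a b ha hb => simp [ha, hb, add_mul]
  | single T a =>
    rw [FF_single, single_apply, single_apply]
    split_ifs with h
    · subst h; simp [ee]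
    · simp

theorem koszul_acyclic (hd : IsD f r d) (hskew : ∀ i j : Fin c, f i * f j = (r i j : k) • (f j * f i))
    (hreg : ∀ (i : Fin c) (g : Q), g * f i ∈ II f i.val → g ∈ II f i.val)
    (m : ℕ) (hm : m ≤ c) : ∀ x ∈ MM Q c m, d x = 0 → x ∅ ∈ II f m → ∃ y ∈ MM Q c m, x = d y := by
  induction m with
  | zero =>
    intro x hx _ h0
    refine ⟨0, zero_mem _, ?_⟩
    have h1 : x ∅ = 0 := by simpa [II] using h0
    rw [map_zero]
    ext T
    by_cases hT : T = ∅
    · subst hT; simpa using h1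
    · refine (Finsupp.mem_supported' Q x).1 hx T fun h => hT ?_
      exact Finset.eq_empty_of_forall_notMem fun s hs => absurd (h s hs) (by omega)
  | succ m ih =>
    intro x hx hdx h0
    have ih' := ih (by omega)
    let M : Fin c := ⟨m, hm⟩
    obtain ⟨u, hu, v, hv, rfl⟩ := decomp (m := M) hx
    have hFv : FF f r M v ∈ MM Q c m := maps_MM (fun T hT => by
      rw [FF_single]; exact single_mem_MM hT _) hv
    have e1 : d v = 0 := by
      have := congrArg (BB Q M) hdx
      rw [map_add, d_AA hd hv, map_add, map_add, BB_MM (d_mem hd hu), BB_AA (d_mem hd hv),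
        BB_MM hFv] at this
      simpa using this
    have e2 : d u + FF f r M v = 0 := by
      rw [map_add, d_AA hd hv, e1] at hdx
      simpa using hdx
    have e3 : v ∅ ∈ II f m := by
      apply hreg M
      have := DFunLike.congr_fun e2 ∅
      rw [Finsupp.add_apply, coef_FF, Finsupp.coe_zero, Pi.zero_apply] at this
      rw [eq_neg_of_add_eq_zero_right this]
      exact neg_mem (coef_d hd hu)
    obtain ⟨w, hw, rfl⟩ := ih' v hv e1 e3
    have hFw : FF f r M w ∈ MM Q c m := maps_MM (fun T hT => by
      rw [FF_single]; exact single_mem_MM hT _) hw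
    have h00 : u ∅ ∈ II f (m+1) := by
      have : AA Q M (d w) = d (AA Q M w) - FF f r M w := by rw [d_AA hd hw]; simp
      rw [this, Finsupp.add_apply, Finsupp.sub_apply, coef_FF] at h0
      have h1 := coef_d hd (AA_mem (m := M) hw)
      have h2 : w ∅ * f M ∈ II f (m+1) :=
        Ideal.mul_mem_left _ _ (Ideal.subset_span ⟨M, Nat.lt_succ_self _, rfl⟩)
      have := sub_mem h0 (sub_mem h1 h2)
      simpa using this
    have hsup : ∃ s ∈ II f m, ∃ t, u ∅ = s + t * f M := by
      have : II f (m+1) ≤ II f m ⊔ Ideal.span {f M} := by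
        refine Ideal.span_le.2 ?_
        rintro _ ⟨j, hj, rfl⟩
        by_cases h : j.val < m
        · exact Ideal.mem_sup_left (Ideal.subset_span ⟨j, h, rfl⟩)
        · have : j = M := Fin.ext (by simp [M]; omega)
          subst this
          exact Ideal.mem_sup_right (Ideal.subset_span rfl)
      obtain ⟨s, hs, _, ht, e⟩ := Submodule.mem_sup.1 (this h00)
      obtain ⟨t, rfl⟩ := Ideal.mem_span_singleton'.1 ht
      exact ⟨s, hs, t, e.symm⟩
    obtain ⟨s, hs, t, hst⟩ := hsup
    -- correction
    let w' := w + single ∅ (t - w ∅)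
    have hemp : (∅ : Finset (Fin c)) ∈ PS c m := by intro s hs; simp at hs
    have hw' : w' ∈ MM Q c m := add_mem hw (single_mem_MM hemp _)
    have hdw' : d w' = d w := by simp [w', d_single hd]
    have hFw' : FF f r M w' ∈ MM Q c m := maps_MM (fun T hT => by
      rw [FF_single]; exact single_mem_MM hT _) hw'
    have hc : (u - FF f r M w') ∅ = s := by
      rw [Finsupp.sub_apply, coef_FF, hst]; simp [w']
    have hdu : d (u - FF f r M w') = 0 := by
      rw [map_sub, d_FF hd hskew hw', hdw', sub_neg_eq_add, e2]
    obtain ⟨y, hy, hyd⟩ := ih' _ (sub_mem hu hFw') hdu (hc ▸ hs)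
    refine ⟨y + AA Q M w', add_mem (MM_mono hy) (AA_mem (m := M) hw'), ?_⟩
    rw [map_add, ← hyd, d_AA hd hw', hdw']
    abel

end abs
end SkewKos

namespace SkewDom
open Finsupp
section dom
variable {k : Type*} [Field k] {n : ℕ} (q : Fin n → Fin n → kˣ)

lemma var_comm (i j : Fin n) :
    skewVar k q i * skewVar k q j = (q i j : k) • (skewVar k q j * skewVar k q i) := by
  unfold skewVar
  rw [← map_mul, ← map_mul, ← map_smul]
  exact RingQuot.mkAlgHom_rel k ⟨i, j, rfl, rfl⟩

def wd (l : List (Fin n)) : SkewPoly k q := (l.map (skewVar k q)).prod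

lemma wd_perm {l l' : List (Fin n)} (h : l.Perm l') :
    ∃ u : k, u ≠ 0 ∧ wd q l = u • wd q l' := by
  induction h with
  | nil => exact ⟨1, one_ne_zero, by simp⟩
  | cons x _ ih =>
    obtain ⟨u, hu, e⟩ := ih
    refine ⟨u, hu, ?_⟩
    simp only [wd, List.map_cons, List.prod_cons] at e ⊢
    rw [e, mul_smul_comm]
  | swap x y l =>
    refine ⟨q y x, (q y x).ne_zero, ?_⟩
    simp only [wd, List.map_cons, List.prod_cons]
    rw [← mul_assoc, ← mul_assoc, var_comm, smul_mul_assoc]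
  | trans _ _ ih1 ih2 =>
    obtain ⟨u, hu, e⟩ := ih1
    obtain ⟨v, hv, e'⟩ := ih2
    exact ⟨u * v, mul_ne_zero hu hv, by rw [e, e', smul_smul]⟩

def XX (a : Fin n →₀ ℕ) : SkewPoly k q := wd q (toMultiset a).toList

lemma XX_mul (a b : Fin n →₀ ℕ) : ∃ u : k, u ≠ 0 ∧ XX q a * XX q b = u • XX q (a + b) := by
  have : XX q a * XX q b = wd q ((toMultiset a).toList ++ (toMultiset b).toList) := by
    simp [XX, wd]
  rw [this]
  apply wd_perm
  rw [← Multiset.coe_eq_coe, ← Multiset.coe_add]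
  simp

lemma XX_span : Submodule.span k (Set.range (XX (k := k) q)) = ⊤ := by
  set P := Submodule.span k (Set.range (XX (k := k) q)) with hP
  have hmul : ∀ x ∈ P, ∀ y ∈ P, x * y ∈ P := by
    intro x hx y hy
    have := Submodule.mul_mem_mul hx hy
    rw [hP, Submodule.span_mul_span] at this
    refine (Submodule.span_le.2 ?_) this
    rintro _ ⟨_, ⟨a, rfl⟩, _, ⟨b, rfl⟩, rfl⟩
    obtain ⟨u, _, e⟩ := XX_mul q a b
    simp only [e]
    exact P.smul_mem _ (Submodule.subset_span ⟨_, rfl⟩)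
  have hone : (1 : SkewPoly k q) ∈ P := Submodule.subset_span ⟨0, by simp [XX, wd]⟩
  rw [eq_top_iff]
  intro x _
  obtain ⟨y, rfl⟩ := RingQuot.mkAlgHom_surjective k (skewRel k q) x
  induction y using FreeAlgebra.induction with
  | grade0 c =>
    rw [AlgHom.commutes, Algebra.algebraMap_eq_smul_one]
    exact P.smul_mem _ hone
  | grade1 i => exact Submodule.subset_span ⟨single i 1, by simp [XX, wd, skewVar]⟩
  | mul a b ha hb => rw [map_mul]; exact hmul _ (ha trivial) _ (hb trivial)
  | add a b ha hb => rw [map_add]; exact add_mem (ha trivial) (hb trivial)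

def chi (i : Fin n) (a : Fin n →₀ ℕ) : k :=
  ∏ j ∈ Finset.univ.filter (fun j => j < i), (q i j : k) ^ (a j)

lemma chi_ne (i : Fin n) (a : Fin n →₀ ℕ) : chi q i a ≠ 0 :=
  Finset.prod_ne_zero_iff.2 fun j _ => pow_ne_zero _ (q i j).ne_zero

lemma chi_add (i j : Fin n) (a : Fin n →₀ ℕ) :
    chi q i (a + single j 1) = (if j < i then (q i j : k) else 1) * chi q i a := by
  unfold chi
  simp only [Finsupp.add_apply, pow_add, Finset.prod_mul_distrib]
  rw [mul_comm]
  congr 1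
  split_ifs with h
  · rw [Finset.prod_eq_single j]
    · simp
    · intro b _ hb; simp [hb.symm]
    · simp [h]
  · refine Finset.prod_eq_one fun b hb => ?_
    have : j ≠ b := by rintro rfl; simp at hb; exact h hb
    simp [this]

def op (i : Fin n) : Module.End k ((Fin n →₀ ℕ) →₀ k) :=
  Finsupp.linearCombination k (fun a => single (a + single i 1) (chi q i a))

lemma op_single (i : Fin n) (a : Fin n →₀ ℕ) (t : k) :
    op q i (single a t) = single (a + single i 1) (t * chi q i a) := by
  simp [op, linearCombination_single]

lemma op_comm (hq1 : ∀ i : Fin n, q i i = 1) (hq2 : ∀ i j : Fin n, q i j = (q j i)⁻¹)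
    (i j : Fin n) : op q i * op q j = (q i j : k) • (op q j * op q i) := by
  refine Finsupp.lhom_ext fun a t => ?_
  simp only [Module.End.mul_apply, LinearMap.smul_apply, op_single, smul_single, chi_add]
  rw [add_right_comm a]
  congr 1
  rcases lt_trichotomy i j with h | rfl | h
  · rw [if_neg (not_lt.2 h.le), if_pos h, hq2 i j]
    have := (q j i).ne_zero
    simp
    field_simp
  · simp [hq1]
  · rw [if_pos h, if_neg (not_lt.2 h.le), smul_eq_mul]
    ring

lemma exists_rep (hq1 : ∀ i : Fin n, q i i = 1) (hq2 : ∀ i j : Fin n, q i j = (q j i)⁻¹) :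
    ∃ ρ : SkewPoly k q →ₐ[k] Module.End k ((Fin n →₀ ℕ) →₀ k),
      ∀ i, ρ (skewVar k q i) = op q i := by
  refine ⟨RingQuot.liftAlgHom k ⟨FreeAlgebra.lift k (op q), ?_⟩, fun i => ?_⟩
  · rintro _ _ ⟨i, j, rfl, rfl⟩
    simp only [map_mul, map_smul, FreeAlgebra.lift_ι_apply]
    exact op_comm q hq1 hq2 i j
  · unfold skewVar
    rw [RingQuot.liftAlgHom_mkAlgHom_apply, FreeAlgebra.lift_ι_apply]

lemma exists_lin (hq1 : ∀ i : Fin n, q i i = 1) (hq2 : ∀ i j : Fin n, q i j = (q j i)⁻¹) :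
    ∃ L : SkewPoly k q →ₗ[k] ((Fin n →₀ ℕ) →₀ k),
      ∀ a, ∃ u : k, u ≠ 0 ∧ L (XX q a) = single a u := by
  obtain ⟨ρ, hρ⟩ := exists_rep q hq1 hq2
  have key : ∀ l : List (Fin n), ∃ u : k, u ≠ 0 ∧
      ρ (wd q l) (single 0 1) = single (Multiset.toFinsupp (l : Multiset (Fin n))) u := by
    intro l
    induction l with
    | nil => exact ⟨1, one_ne_zero, by simp [wd]⟩
    | cons i l ih =>
      obtain ⟨u, hu, e⟩ := ih
      refine ⟨_, mul_ne_zero hu (chi_ne q i (Multiset.toFinsupp (l : Multiset (Fin n)))), ?_⟩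
      have : wd q (i :: l) = skewVar k q i * wd q l := by simp [wd]
      rw [this, map_mul, Module.End.mul_apply, e, hρ, op_single, ← Multiset.cons_coe,
        ← Multiset.singleton_add, Multiset.toFinsupp_add, Multiset.toFinsupp_singleton, add_comm]
  refine ⟨(LinearMap.applyₗ (single 0 1)) ∘ₗ ρ.toLinearMap, fun a => ?_⟩
  obtain ⟨u, hu, e⟩ := key (toMultiset a).toList
  refine ⟨u, hu, ?_⟩
  simpa [XX] using e

theorem noZeroDiv (hq1 : ∀ i : Fin n, q i i = 1) (hq2 : ∀ i j : Fin n, q i j = (q j i)⁻¹)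
    (x y : SkewPoly k q) (hxy : x * y = 0) : x = 0 ∨ y = 0 := by
  obtain ⟨L, hL⟩ := exists_lin q hq1 hq2
  have hx : x ∈ Submodule.span k (Set.range (XX (k := k) q)) := by rw [XX_span]; trivial
  have hy : y ∈ Submodule.span k (Set.range (XX (k := k) q)) := by rw [XX_span]; trivial
  obtain ⟨s, rfl⟩ := (Finsupp.mem_span_range_iff_exists_finsupp).1 hx
  obtain ⟨t, rfl⟩ := (Finsupp.mem_span_range_iff_exists_finsupp).1 hy
  by_contra hcon
  push Not at hcon
  have hs : s.support.Nonempty := by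
    rw [Finsupp.support_nonempty_iff]; rintro rfl; simp at hcon
  have ht : t.support.Nonempty := by
    rw [Finsupp.support_nonempty_iff]; rintro rfl; simp at hcon
  obtain ⟨a, ha, b, hb, hu⟩ := UniqueSums.uniqueAdd_of_nonempty hs ht
  have hterm : ∀ a' b', ∃ u : k, u ≠ 0 ∧
      L ((s a' • XX q a') * (t b' • XX q b')) = single (a' + b') (s a' * t b' * u) := by
    intro a' b'
    obtain ⟨u, hu, e⟩ := XX_mul q a' b'
    obtain ⟨v, hv, e'⟩ := hL (a' + b')
    refine ⟨u * v, mul_ne_zero hu hv, ?_⟩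
    rw [smul_mul_smul_comm, e, map_smul, map_smul, e', smul_single, smul_single]
    simp [mul_assoc]
  have h0 : (L ((s.sum fun i c => c • XX q i) * (t.sum fun i c => c • XX q i))) (a + b) = 0 := by
    rw [hxy]; simp
  rw [Finsupp.sum, Finsupp.sum, Finset.sum_mul_sum, map_sum, Finsupp.finsetSum_apply,
    Finset.sum_eq_single a, map_sum, Finsupp.finsetSum_apply, Finset.sum_eq_single b] at h0
  · obtain ⟨u, hu', e⟩ := hterm a b
    rw [e, single_eq_same] at h0
    exact mul_ne_zero (mul_ne_zero (mem_support_iff.1 ha) (mem_support_iff.1 hb)) hu' h0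
  · intro b' hb' hne
    obtain ⟨u, hu', e⟩ := hterm a b'
    rw [e, single_apply, if_neg]
    intro h
    exact hne (hu ha hb' h).2
  · intro h; exact absurd hb h
  · intro a' ha' hne
    rw [map_sum, Finsupp.finsetSum_apply]
    refine Finset.sum_eq_zero fun b' hb' => ?_
    obtain ⟨u, hu', e⟩ := hterm a' b'
    rw [e, single_apply, if_neg]
    intro h
    exact hne (hu ha' hb' h).1
  · intro h; exact absurd ha h

end dom
end SkewDom

/-- Let Q be a skew polynomial ring and f₁,…,f_c a regular sequence of
homogeneous normal elements of Q.  Then the skew Koszul complex K^Q(f₁,…,f_c) (modelled as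
the free left Q-module `Finset (Fin c) →₀ Q` on the exterior monomials, with the skew
Koszul differential) is a free resolution of Q/(f₁,…,f_c) over Q:
H_i(K^Q(f)) = 0 for i > 0 and H_0(K^Q(f)) = Q/(f₁,…,f_c). -/
theorem skew_koszul_resolution {k : Type} [Field k] {n : ℕ}
    (q : Fin n → Fin n → kˣ)
    (hq1 : ∀ i : Fin n, q i i = 1)
    (hq2 : ∀ i j : Fin n, q i j = (q j i)⁻¹)
    {c : ℕ} (f : Fin c → SkewPoly k q)
    (deg : Fin c → ℕ)
    -- each f i is homogeneous:
    (hhom : ∀ i : Fin c, f i ∈ wordSpan k q (deg i))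
    -- each f i is normal:
    (hnorm₁ : ∀ (i : Fin c) (a : SkewPoly k q), ∃ b, f i * a = b * f i)
    (hnorm₂ : ∀ (i : Fin c) (a : SkewPoly k q), ∃ b, a * f i = f i * b)
    -- f₁,…,f_c is a regular sequence:
    (hreg : ∀ (i : Fin c) (g : SkewPoly k q),
      f i * g ∈ Ideal.span {y | ∃ j : Fin c, j < i ∧ y = f j} →
      g ∈ Ideal.span {y | ∃ j : Fin c, j < i ∧ y = f j})
    -- the skew commutation constants r_{ij} (automatic for normal elements of Q):
    (r : Fin c → Fin c → kˣ)
    (hskew : ∀ i j : Fin c, f i * f j = (r i j : k) • (f j * f i))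
    -- the skew Koszul differential:
    (d : (Finset (Fin c) →₀ SkewPoly k q) →ₗ[SkewPoly k q] (Finset (Fin c) →₀ SkewPoly k q))
    (hd : ∀ S : Finset (Fin c),
      d (Finsupp.single S (1 : SkewPoly k q)) =
        ∑ j ∈ S, ((-1 : ℤ) ^ ((S.filter (fun s => s < j)).card)) •
          Finsupp.single (S.erase j)
            ((∏ s ∈ S.filter (fun s => s < j), (r s j : k)) • f j)) :
    -- H_i = 0 for i > 0 (cycles supported in positive homological degree are boundaries):
    (∀ x : Finset (Fin c) →₀ SkewPoly k q, d x = 0 →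
      (∀ S ∈ x.support, S ≠ (∅ : Finset (Fin c))) → ∃ y, x = d y) ∧
    -- H_0 = Q/(f₁,…,f_c):
    (∀ g : SkewPoly k q,
      (∃ y, (Finsupp.single (∅ : Finset (Fin c)) g) = d y) ↔
        g ∈ Ideal.span (Set.range f)) := by
  have hd' : SkewKos.IsD f r d := by
    intro S
    rw [hd]
    refine Finset.sum_congr rfl fun j _ => ?_
    unfold SkewKos.ee
    rw [mul_smul]
    rcases neg_one_pow_eq_or ℤ ((S.filter (fun s => s < j)).card) with h | h
    · have h2 : ((-1 : k)) ^ ((S.filter (fun s => s < j)).card) = 1 := by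
        have := congrArg (Int.cast : ℤ → k) h
        push_cast at this
        exact this
      rw [h, h2, one_smul]
      exact one_zsmul (G := Finset (Fin c) →₀ SkewPoly k q) _
    · have h2 : ((-1 : k)) ^ ((S.filter (fun s => s < j)).card) = -1 := by
        have := congrArg (Int.cast : ℤ → k) h
        push_cast at this
        exact this
      rw [h, h2, neg_smul, one_smul, Finsupp.single_neg]
      exact neg_one_zsmul (G := Finset (Fin c) →₀ SkewPoly k q) _
  have hr : ∀ (i : Fin c) (g : SkewPoly k q), g * f i ∈ SkewKos.II f i.val →
      g ∈ SkewKos.II f i.val := by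
    intro i g hg
    obtain ⟨b, hb⟩ := hnorm₂ i g
    have hbI : b ∈ SkewKos.II f i.val := hreg i b (hb ▸ hg)
    -- elements of the ideal can be moved past `f i`
    have hmove : ∀ b ∈ SkewKos.II f i.val, ∃ b' ∈ SkewKos.II f i.val, f i * b = b' * f i := by
      intro b hb
      induction hb using Submodule.span_induction with
      | mem x hx =>
        obtain ⟨j, hj, rfl⟩ := hx
        refine ⟨(r i j : k) • f j, ?_, by rw [hskew i j, smul_mul_assoc]⟩
        rw [Algebra.smul_def]
        exact Ideal.mul_mem_left _ _ (Ideal.subset_span ⟨j, hj, rfl⟩)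
      | zero => exact ⟨0, zero_mem _, by simp⟩
      | add x y _ _ hx hy =>
        obtain ⟨x', hx', ex⟩ := hx
        obtain ⟨y', hy', ey⟩ := hy
        exact ⟨x' + y', add_mem hx' hy', by rw [mul_add, add_mul, ex, ey]⟩
      | smul a x _ hx =>
        obtain ⟨x', hx', ex⟩ := hx
        obtain ⟨a', ea⟩ := hnorm₁ i a
        exact ⟨a' * x', Ideal.mul_mem_left _ _ hx', by
          rw [smul_eq_mul, ← mul_assoc, ea, mul_assoc, ex, mul_assoc]⟩
    obtain ⟨b', hb', e⟩ := hmove b hbI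
    have h0 : (g - b') * f i = 0 := by rw [sub_mul, hb, e, sub_self]
    rcases SkewDom.noZeroDiv q hq1 hq2 _ _ h0 with h | h
    · rw [sub_eq_zero.1 h]; exact hb'
    · refine hreg i g ?_
      rw [h, zero_mul]
      exact zero_mem _
  have hMM : ∀ x, x ∈ SkewKos.MM (SkewPoly k q) c c := by
    intro x
    refine (Finsupp.mem_supported _ _).2 fun T _ => ?_
    intro s _
    exact s.isLt
  have hII : SkewKos.II f c = Ideal.span (Set.range f) := by
    unfold SkewKos.II
    congr 1
    ext y
    constructor
    · rintro ⟨j, _, rfl⟩; exact ⟨j, rfl⟩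
    · rintro ⟨j, rfl⟩; exact ⟨j, j.isLt, rfl⟩
  have hex := SkewKos.koszul_acyclic hd' hskew hr c le_rfl
  refine ⟨fun x hx hsupp => ?_, fun g => ⟨?_, fun hg => ?_⟩⟩
  · obtain ⟨y, _, hy⟩ := hex x (hMM x) hx (by
      have : x ∅ = 0 := by
        by_contra h
        exact hsupp ∅ (Finsupp.mem_support_iff.2 h) rfl
      rw [this]
      exact zero_mem _)
    exact ⟨y, hy⟩
  · rintro ⟨y, hy⟩
    have := SkewKos.coef_d hd' (hMM y)
    rw [← hy, hII, Finsupp.single_eq_same] at this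
    exact this
  · obtain ⟨y, _, hy⟩ := hex (Finsupp.single ∅ g) (hMM _) (by
      rw [SkewKos.d_single hd']; simp) (by rw [hII, Finsupp.single_eq_same]; exact hg)
    exact ⟨y, hy⟩
end
end

section
/- Let R = Q/(f₁,…,f_c) be a skew complete intersection, where Q is a skew polynomial ring in n variables and f₁,…,f_c is a regular sequence of homogeneous normal elements contained in (x₁,…,xₙ)². Then the Poincaré series of k over R is P^R_k(t) = Σ_{i≥0} dim_k Ext_R^i(k,k) t^i = (1+t)^n / (1-t²)^c. -/
noncomputable section

open CategoryTheory

namespace SkewCI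

section ExtPart

variable {k R : Type} [Field k] [Ring R] [Algebra k R] (ε : R →ₐ[k] k)

/-- The residue module as an object of the category of modules. -/
abbrev resObj : ModuleCat.{0} R := ModuleCat.of R (R ⧸ RingHom.ker (ε : R →+* k))

variable (ι : ℕ → Type) (D : ∀ i, (ι (i + 1) →₀ R) →ₗ[R] (ι i →₀ R))
  (hD2 : ∀ i v, D i (D (i + 1) v) = 0)

def cplx : ChainComplex (ModuleCat.{0} R) ℕ :=
  ChainComplex.of (fun i => ModuleCat.of R (ι i →₀ R)) (fun i => ModuleCat.ofHom (D i))
    (fun i => by ext1; exact LinearMap.ext (hD2 i))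

variable [Unique (ι 0)]
  (hmin : ∀ i v e, ε (D i v e) = 0)

/-- The augmentation map. -/
def augMap : (ι 0 →₀ R) →ₗ[R] (R ⧸ RingHom.ker (ε : R →+* k)) :=
  (Submodule.mkQ (RingHom.ker (ε : R →+* k))).comp (Finsupp.lapply default)

lemma augMap_eq_zero (v : ι 0 →₀ R) : augMap ε ι v = 0 ↔ ε (v default) = 0 := by
  simp only [augMap, LinearMap.comp_apply, Submodule.mkQ_apply, Submodule.Quotient.mk_eq_zero]
  exact Iff.rfl

lemma augMap_surj : Function.Surjective (augMap ε ι) := by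
  intro y
  obtain ⟨r, rfl⟩ := Submodule.mkQ_surjective _ y
  exact ⟨Finsupp.single default r, by simp [augMap]⟩

omit [Unique (ι 0)] in
lemma cplx_d (i : ℕ) : (cplx ι D hD2).d (i + 1) i = ModuleCat.ofHom (D i) := by
  simp [cplx, ChainComplex.of_d]

def cplxπ : cplx ι D hD2 ⟶ (ChainComplex.single₀ (ModuleCat.{0} R)).obj (resObj ε) :=
  ((cplx ι D hD2).toSingle₀Equiv _).symm ⟨ModuleCat.ofHom (augMap ε ι), by
    rw [cplx_d]
    ext1
    exact LinearMap.ext fun v => (augMap_eq_zero ε ι _).2 (hmin 0 v _)⟩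

lemma cplxπ_f : (cplxπ ε ι D hD2 hmin).f 0 = ModuleCat.ofHom (augMap ε ι) := by
  exact ChainComplex.toSingle₀Equiv_symm_apply_f_zero _ _

lemma cplxπ_quasiIso (hex : ∀ i v, D i v = 0 → ∃ w, D (i + 1) w = v)
    (hex0 : ∀ v : ι 0 →₀ R, ε (v default) = 0 → ∃ w, D 0 w = v) :
    QuasiIso (cplxπ ε ι D hD2 hmin) where
  quasiIsoAt m := by
    cases m with
    | zero =>
      rw [ChainComplex.quasiIsoAt₀_iff, ShortComplex.quasiIso_iff_of_zeros' _ rfl rfl rfl]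
      constructor
      · rw [ShortComplex.moduleCat_exact_iff]
        intro x hx
        have hx' : augMap ε ι x = 0 := by
          have h : ((cplxπ ε ι D hD2 hmin).f 0).hom x = 0 := hx
          rwa [cplxπ_f] at h
        obtain ⟨w, hw⟩ := hex0 x ((augMap_eq_zero ε ι _).1 hx')
        refine ⟨w, ?_⟩
        have := cplx_d ι D hD2 0
        change ((cplx ι D hD2).d 1 0).hom w = x
        rw [this]; exact hw
      · rw [ModuleCat.epi_iff_surjective]
        intro y
        obtain ⟨v, hv⟩ := augMap_surj ε ι y
        refine ⟨v, ?_⟩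
        change ((cplxπ ε ι D hD2 hmin).f 0).hom v = y
        rw [cplxπ_f]; exact hv
    | succ m =>
      rw [quasiIsoAt_iff_exactAt' (hL := ChainComplex.exactAt_succ_single_obj ..),
          HomologicalComplex.exactAt_iff' _ (m + 2) (m + 1) m (by simp) (by simp)]
      rw [ShortComplex.moduleCat_exact_iff]
      intro x hx
      have hx' : D m x = 0 := by
        have h : ((cplx ι D hD2).d (m+1) m).hom x = 0 := hx
        rwa [cplx_d] at h
      obtain ⟨w, hw⟩ := hex m x hx'
      refine ⟨w, ?_⟩
      change ((cplx ι D hD2).d (m+1+1) (m+1)).hom w = x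
      rw [cplx_d]; exact hw

/-- The projective resolution. -/
def projRes (hex : ∀ i v, D i v = 0 → ∃ w, D (i + 1) w = v)
    (hex0 : ∀ v : ι 0 →₀ R, ε (v default) = 0 → ∃ w, D 0 w = v) :
    ProjectiveResolution (resObj ε) where
  complex := cplx ι D hD2
  projective i := by
    change Projective (ModuleCat.of R (ι i →₀ R))
    exact ModuleCat.projective_of_free (Finsupp.basisSingleOne)
  π := cplxπ ε ι D hD2 hmin
  quasiIso := cplxπ_quasiIso ε ι D hD2 hmin hex hex0

/-- The residue field, as a linear map out of the residue module. -/
def resMap : (R ⧸ RingHom.ker (ε : R →+* k)) → k :=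
  Quotient.lift (s := Submodule.quotientRel (RingHom.ker (ε : R →+* k))) (fun r => ε r) (by
    intro a b h
    have h2 : a - b ∈ RingHom.ker (ε : R →+* k) := by
      rw [← Submodule.quotientRel_def]; exact h
    have h3 : ε (a - b) = 0 := h2
    rwa [map_sub, sub_eq_zero] at h3)

lemma resMap_mk (r : R) : resMap ε (Submodule.Quotient.mk r) = ε r := rfl

lemma resMap_smul (a : R) (y : R ⧸ RingHom.ker (ε : R →+* k)) :
    resMap ε (a • y) = ε a * resMap ε y := by
  obtain ⟨r, rfl⟩ := Submodule.Quotient.mk_surjective _ y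
  rw [← Submodule.Quotient.mk_smul, resMap_mk, resMap_mk, smul_eq_mul, map_mul]

lemma resMap_add (x y : R ⧸ RingHom.ker (ε : R →+* k)) :
    resMap ε (x + y) = resMap ε x + resMap ε y := by
  obtain ⟨r, rfl⟩ := Submodule.Quotient.mk_surjective _ y
  obtain ⟨s, rfl⟩ := Submodule.Quotient.mk_surjective _ x
  rw [← Submodule.Quotient.mk_add, resMap_mk, resMap_mk, resMap_mk, map_add]

lemma resMap_inj : Function.Injective (resMap ε) := by
  intro x y h
  obtain ⟨r, rfl⟩ := Submodule.Quotient.mk_surjective _ y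
  obtain ⟨s, rfl⟩ := Submodule.Quotient.mk_surjective _ x
  rw [resMap_mk, resMap_mk] at h
  rw [Submodule.Quotient.eq]
  change ε (s - r) = 0
  rw [map_sub, h, sub_self]

lemma finrank_hom (ι₀ : Type) [Finite ι₀] :
    @Module.finrank k (ModuleCat.of R (ι₀ →₀ R) ⟶ resObj ε) _ _
      (Linear.homModule (R := k) (ModuleCat.of R (ι₀ →₀ R)) (resObj ε)) = Nat.card ι₀ := by
  letI : Module k (ModuleCat.of R (ι₀ →₀ R) ⟶ resObj ε) :=
    Linear.homModule (R := k) (ModuleCat.of R (ι₀ →₀ R)) (resObj ε)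
  let Φ : (ModuleCat.of R (ι₀ →₀ R) ⟶ resObj ε) →ₗ[k] (ι₀ → k) :=
    { toFun := fun φ e => resMap ε (φ.hom (Finsupp.single e 1))
      map_add' := fun φ ψ => by
        funext e
        exact resMap_add ε _ _
      map_smul' := fun a φ => by
        funext e
        change resMap ε ((algebraMap k R a) • φ.hom (Finsupp.single e 1)) = _
        rw [resMap_smul]
        simp }
  have hΦ : Function.Bijective Φ := by
    constructor
    · intro φ ψ h
      ext e
      exact resMap_inj ε (congrFun h e)
    · intro g
      refine ⟨ModuleCat.ofHom (Finsupp.linearCombination R fun e =>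
        (Submodule.Quotient.mk (algebraMap k R (g e)) : R ⧸ RingHom.ker (ε : R →+* k))), ?_⟩
      funext e
      change resMap ε ((Finsupp.linearCombination R fun e =>
        (Submodule.Quotient.mk (algebraMap k R (g e)) : R ⧸ RingHom.ker (ε : R →+* k)))
          (Finsupp.single e 1)) = g e
      rw [Finsupp.linearCombination_single, one_smul, resMap_mk]
      simp
  rw [(LinearEquiv.ofBijective Φ hΦ).finrank_eq]
  have := Fintype.ofFinite ι₀
  simp

theorem finrank_ext (hD2 : ∀ i v, D i (D (i + 1) v) = 0)
    (hmin : ∀ i v e, ε (D i v e) = 0) (hfin : ∀ i, Finite (ι i))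
    (hex : ∀ i v, D i v = 0 → ∃ w, D (i + 1) w = v)
    (hex0 : ∀ v : ι 0 →₀ R, ε (v default) = 0 → ∃ w, D 0 w = v) (i : ℕ) :
    Module.finrank k
          (((Ext k (ModuleCat R) i).obj
              (Opposite.op (ModuleCat.of R (R ⧸ RingHom.ker (ε : R →+* k))))).obj
            (ModuleCat.of R (R ⧸ RingHom.ker (ε : R →+* k)))) = Nat.card (ι i) := by
  have e1 := ((projRes ε ι D hD2 hmin hex hex0).isoExt (R := k) i (resObj ε))
  have hz : ∀ a b, ((projRes ε ι D hD2 hmin hex hex0).complex.linearYonedaObj k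
    (resObj ε)).d a b = 0 := by
    intro a b
    by_cases hab : a + 1 = b
    · subst hab
      ext1
      refine LinearMap.ext fun φ => ?_
      change (cplx ι D hD2).d (a + 1) a ≫ φ = 0
      rw [cplx_d]
      ext1
      refine LinearMap.ext fun v => ?_
      change ModuleCat.Hom.hom φ (D a v) = 0
      have hφ : ∀ u : ι a →₀ R, (∀ e, ε (u e) = 0) → ModuleCat.Hom.hom φ u = 0 := by
        intro u hu
        rw [← Finsupp.sum_single u, Finsupp.sum]
        erw [map_sum]
        refine Finset.sum_eq_zero fun e _ => resMap_inj ε ?_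
        have h1 : (Finsupp.single e (u e) : ι a →₀ R) = u e • Finsupp.single e 1 := by simp
        rw [h1]
        erw [map_smul, resMap_smul]
        rw [hu, zero_mul]
        exact (map_zero ε).symm
      exact hφ _ (hmin a v)
    · exact HomologicalComplex.shape _ _ _ hab
  have e2 := (ShortComplex.HomologyData.ofZeros
    (((projRes ε ι D hD2 hmin hex hex0).complex.linearYonedaObj k
    (resObj ε)).sc i) (hz _ _) (hz _ _)).left.homologyIso
  have e3 := (e1 ≪≫ e2).toLinearEquiv
  rw [e3.finrank_eq]
  have := hfin i
  exact finrank_hom ε (ι i)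

end ExtPart
end SkewCI


namespace SkewCI

section QPart

variable {k : Type} [Field k] {n : ℕ} (q : Fin n → Fin n → kˣ)

/-- product of a word -/
def wp (w : List (Fin n)) : SkewPoly k q := (w.map (skewVar k q)).prod

/-- colour of a word -/
def col (w : List (Fin n)) (i : Fin n) : kˣ := (w.map (fun a => q a i)).prod

@[simp] lemma wp_nil : wp q [] = 1 := rfl
@[simp] lemma wp_cons (i : Fin n) (w : List (Fin n)) :
    wp q (i :: w) = skewVar k q i * wp q w := by simp [wp]
lemma wp_append (v w : List (Fin n)) : wp q (v ++ w) = wp q v * wp q w := by simp [wp]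
@[simp] lemma wp_single (i : Fin n) : wp q [i] = skewVar k q i := by simp [wp]
@[simp] lemma col_nil (i : Fin n) : col q [] i = 1 := rfl
@[simp] lemma col_cons (a : Fin n) (w : List (Fin n)) (i : Fin n) :
    col q (a :: w) i = q a i * col q w i := by simp [col]

lemma rel (i j : Fin n) : skewVar k q i * skewVar k q j =
    (q i j : k) • (skewVar k q j * skewVar k q i) := by
  have := RingQuot.mkAlgHom_rel k (s := skewRel k q) (x := FreeAlgebra.ι k i * FreeAlgebra.ι k j)
    ⟨i, j, rfl, rfl⟩
  simpa [skewVar] using this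

lemma wp_mul_x (w : List (Fin n)) (i : Fin n) :
    wp q w * skewVar k q i = (col q w i : k) • (skewVar k q i * wp q w) := by
  induction w with
  | nil => simp
  | cons a w ih =>
    rw [wp_cons, mul_assoc, ih, mul_smul_comm, ← mul_assoc, rel, smul_mul_assoc, smul_smul,
      col_cons, mul_assoc, mul_comm (col q w i : k)]
    simp

lemma span_wp : Submodule.span k (Set.range (wp q)) = ⊤ := by
  rw [eq_top_iff]
  rintro a -
  obtain ⟨a, rfl⟩ := RingQuot.mkAlgHom_surjective k (skewRel k q) a
  induction a using FreeAlgebra.induction with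
  | grade0 r =>
    rw [AlgHom.commutes, Algebra.algebraMap_eq_smul_one]
    exact Submodule.smul_mem _ _ (Submodule.subset_span ⟨[], rfl⟩)
  | grade1 i => exact Submodule.subset_span ⟨[i], by simp [skewVar]⟩
  | mul a b ha hb =>
    rw [map_mul]
    have := Submodule.mul_mem_mul ha hb
    rw [Submodule.span_mul_span] at this
    refine Submodule.span_mono ?_ this
    rintro _ ⟨_, ⟨v, rfl⟩, _, ⟨w, rfl⟩, rfl⟩
    exact ⟨v ++ w, wp_append q v w⟩
  | add a b ha hb => rw [map_add]; exact Submodule.add_mem _ ha hb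

lemma word_induction {P : SkewPoly k q → Prop} (h0 : P 0) (hw : ∀ w, P (wp q w))
    (hadd : ∀ a b, P a → P b → P (a + b)) (hs : ∀ (c : k) a, P a → P (c • a)) (a) : P a := by
  have : a ∈ Submodule.span k (Set.range (wp q)) := by rw [span_wp]; trivial
  induction this using Submodule.span_induction with
  | mem x h => obtain ⟨w, rfl⟩ := h; exact hw w
  | zero => exact h0
  | add x y _ _ hx hy => exact hadd _ _ hx hy
  | smul c x _ hx => exact hs _ _ hx

/-- pairing of words -/
def BB (u w : List (Fin n)) : kˣ := (w.map (col q u)).prod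

lemma col_cons_fun (a : Fin n) (w u : List (Fin n)) :
    (u.map (col q (a :: w))).prod = (u.map (q a)).prod * (u.map (col q w)).prod := by
  rw [← List.prod_map_mul]
  congr 1

lemma BB_swap (hq2 : ∀ i j, q i j = (q j i)⁻¹) (u w : List (Fin n)) : BB q u w * BB q w u = 1 := by
  induction w with
  | nil =>
    have : col q [] = 1 := by funext i; rfl
    simp [BB, this, Pi.one_def]
  | cons a w ih =>
    have h1 : BB q u (a :: w) = col q u a * BB q u w := by simp [BB]
    have h2 : BB q (a :: w) u = (u.map (q a)).prod * BB q w u := by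
      simp only [BB]
      rw [col_cons_fun]
    have h3 : col q u a * (u.map (q a)).prod = 1 := by
      rw [col, ← List.prod_map_mul]
      have : (fun i => q i a * q a i) = fun _ => 1 := by
        funext i; rw [hq2 i a]; simp
      rw [this]; simp
    rw [h1, h2, mul_mul_mul_comm, h3, ih, one_mul]

lemma BB_self (hq1 : ∀ i, q i i = 1) (hq2 : ∀ i j, q i j = (q j i)⁻¹) (u : List (Fin n)) :
    BB q u u = 1 := by
  induction u with
  | nil => simp [BB]
  | cons a u ih =>
    have h3 : col q u a * (u.map (q a)).prod = 1 := by
      rw [col, ← List.prod_map_mul]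
      have : (fun i => q i a * q a i) = fun _ => 1 := by
        funext i; rw [hq2 i a]; simp
      rw [this]; simp
    have h1 : BB q (a :: u) (a :: u) = (q a a * col q u a) * ((u.map (q a)).prod * BB q u u) := by
      simp only [BB, List.map_cons, List.prod_cons]
      rw [col_cons_fun, col_cons]
    rw [h1, ih, hq1, one_mul, mul_one, h3]

/-- functions whose extension to words depends only on the colour -/
def Good (χ : Fin n → kˣ) : Prop :=
  ∀ w w', col q w = col q w' → (w.map χ).prod = (w'.map χ).prod

lemma good_col (hq2 : ∀ i j, q i j = (q j i)⁻¹) (u : List (Fin n)) : Good q (col q u) := by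
  intro w w' h
  have h1 := BB_swap q hq2 u w
  have h2 := BB_swap q hq2 u w'
  have h3 : BB q w u = BB q w' u := by simp [BB, h]
  rw [← h3] at h2
  exact mul_right_cancel (h1.trans h2.symm)

lemma good_one : Good q 1 := by intro w w' _; simp [Pi.one_def]

lemma good_mul {χ ψ : Fin n → kˣ} (h1 : Good q χ) (h2 : Good q ψ) : Good q (χ * ψ) := by
  intro w w' h
  simp only [Pi.mul_def, List.prod_map_mul]
  rw [h1 w w' h, h2 w w' h]

lemma good_inv {χ : Fin n → kˣ} (h1 : Good q χ) : Good q (χ⁻¹) := by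
  intro w w' h
  have := h1 w w' h
  have e : ∀ w : List (Fin n), (w.map χ⁻¹).prod = ((w.map χ).prod)⁻¹ := by
    intro w; induction w <;> simp_all [mul_comm]
  rw [e, e, this]

lemma good_pow {χ : Fin n → kˣ} (h1 : Good q χ) (m : ℕ) : Good q (χ ^ m) := by
  induction m with
  | zero => rw [pow_zero]; exact good_one q
  | succ m ih => rw [pow_succ]; exact good_mul q ih h1

/-- colour-homogeneous elements of a given degree -/
def CW (d : ℕ) (w0 : List (Fin n)) : Submodule k (SkewPoly k q) :=
  Submodule.span k {m | ∃ w : List (Fin n), w.length = d ∧ col q w = col q w0 ∧ m = wp q w}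

/-- diagonal automorphism -/
def sig (θ : Fin n → kˣ) : SkewPoly k q →ₐ[k] SkewPoly k q :=
  RingQuot.liftAlgHom k ⟨FreeAlgebra.lift k (fun i => (θ i : k) • skewVar k q i), by
    rintro _ _ ⟨i, j, rfl, rfl⟩
    simp only [map_mul, map_smul, FreeAlgebra.lift_ι_apply, smul_mul_smul_comm]
    rw [rel, smul_smul, smul_smul]
    congr 1; ring⟩

@[simp] lemma sig_x (θ : Fin n → kˣ) (i : Fin n) :
    sig q θ (skewVar k q i) = (θ i : k) • skewVar k q i := by
  simp [sig, skewVar]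

lemma sig_wp (θ : Fin n → kˣ) (w : List (Fin n)) :
    sig q θ (wp q w) = ((w.map θ).prod : k) • wp q w := by
  induction w with
  | nil => simp
  | cons a w ih =>
    rw [wp_cons, map_mul, ih, sig_x, smul_mul_smul_comm]
    simp

lemma sig_sig (θ : Fin n → kˣ) (a : SkewPoly k q) : sig q θ (sig q θ⁻¹ a) = a := by
  induction a using word_induction with
  | h0 => simp
  | hw w =>
    rw [sig_wp, map_smul, sig_wp, smul_smul]
    have e : ((w.map θ⁻¹).prod : kˣ) * (w.map θ).prod = 1 := by
      rw [← List.prod_map_mul]; simp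
    rw [← Units.val_mul, e]; simp
  | hadd a b ha hb => simp [ha, hb]
  | hs c a ha => simp [ha]

lemma sig_CW {θ : Fin n → kˣ} (hθ : Good q θ) {d : ℕ} {w0 : List (Fin n)} {f : SkewPoly k q}
    (hf : f ∈ CW q d w0) : sig q θ f = ((w0.map θ).prod : k) • f := by
  induction hf using Submodule.span_induction with
  | mem x h =>
    obtain ⟨w, -, h2, rfl⟩ := h
    rw [sig_wp, hθ w w0 h2]
  | zero => simp
  | add x y _ _ hx hy => simp [hx, hy]
  | smul c x _ hx => rw [map_smul, hx, smul_comm]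

lemma CW_mul_x {d : ℕ} {w0 : List (Fin n)} {f : SkewPoly k q} (hf : f ∈ CW q d w0) (i : Fin n) :
    f * skewVar k q i = (col q w0 i : k) • (skewVar k q i * f) := by
  induction hf using Submodule.span_induction with
  | mem x h =>
    obtain ⟨w, -, h2, rfl⟩ := h
    rw [wp_mul_x, h2]
  | zero => simp
  | add x y _ _ hx hy => simp [hx, hy, add_mul, mul_add]
  | smul c x _ hx => rw [smul_mul_assoc, hx, smul_comm, mul_smul_comm]

lemma CW_comm {d : ℕ} {w0 : List (Fin n)} {f : SkewPoly k q} (hf : f ∈ CW q d w0)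
    (a : SkewPoly k q) : f * a = sig q (col q w0) a * f := by
  induction a using word_induction with
  | h0 => simp
  | hw w =>
    induction w with
    | nil => simp
    | cons i w ih =>
      rw [wp_cons, ← mul_assoc, CW_mul_x q hf, smul_mul_assoc, mul_assoc, ih, map_mul, sig_x,
        smul_mul_assoc, smul_mul_assoc, mul_assoc]
  | hadd a b ha hb => simp [ha, hb, add_mul, mul_add]
  | hs c a ha => simp [ha]

/-- right regularity from left regularity -/
lemma reg_right (hq2 : ∀ i j, q i j = (q j i)⁻¹) {d : ℕ} {w0 : List (Fin n)} {f : SkewPoly k q}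
    (hf : f ∈ CW q d w0) (S : Set (SkewPoly k q))
    (hS : ∀ g ∈ S, ∃ d w, g ∈ CW q d w)
    (hreg : ∀ g, f * g ∈ Ideal.span S → g ∈ Ideal.span S) (a : SkewPoly k q)
    (ha : a * f ∈ Ideal.span S) : a ∈ Ideal.span S := by
  have hgood := good_col q hq2 w0
  have h1 : a * f = f * sig q (col q w0)⁻¹ a := by
    rw [CW_comm q hf, sig_sig]
  rw [h1] at ha
  have h2 := hreg _ ha
  have h3 : ∀ b ∈ Ideal.span S, sig q (col q w0) b ∈ Ideal.span S := by
    intro b hb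
    induction hb using Submodule.span_induction with
    | mem x h =>
      obtain ⟨d, w, hx⟩ := hS x h
      rw [sig_CW q hgood hx, Algebra.smul_def]
      exact Ideal.mul_mem_left _ _ (Ideal.subset_span h)
    | zero => simp
    | add x y _ _ hx hy => rw [map_add]; exact add_mem hx hy
    | smul c x _ hx =>
      rw [smul_eq_mul, map_mul]; exact Ideal.mul_mem_left _ _ hx
  have := h3 _ h2
  rwa [sig_sig] at this

end QPart
end SkewCI


namespace SkewCI

section MonPart

variable {k : Type} [Field k] {n : ℕ} (q : Fin n → Fin n → kˣ)

/-- normal ordering coefficient -/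
def cc (i : Fin n) (α : Fin n →₀ ℕ) : kˣ := ∏ j ∈ Finset.univ.filter (· < i), (q i j) ^ (α j)

lemma cc_add (i : Fin n) (α β : Fin n →₀ ℕ) : cc q i (α + β) = cc q i α * cc q i β := by
  simp [cc, pow_add, Finset.prod_mul_distrib]

lemma cc_single (i j : Fin n) :
    cc q i (Finsupp.single j 1) = if j < i then q i j else 1 := by
  classical
  rw [cc]
  split_ifs with h
  · rw [Finset.prod_eq_single j]
    · simp
    · intro b _ hb; simp [Finsupp.single_apply, hb.symm]
    · intro hj; simp [h] at hj
  · refine Finset.prod_eq_one fun b hb => ?_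
    have : b < i := by simpa using hb
    have hne : j ≠ b := by rintro rfl; exact h this
    simp [Finsupp.single_apply, hne]

/-- the operator of multiplication by a variable on the monomial space -/
def XX (i : Fin n) : Module.End k ((Fin n →₀ ℕ) →₀ k) :=
  Finsupp.linearCombination k (fun α => Finsupp.single (α + Finsupp.single i 1) (cc q i α : k))

lemma XX_single (i : Fin n) (α : Fin n →₀ ℕ) (c : k) :
    XX q i (Finsupp.single α c) = Finsupp.single (α + Finsupp.single i 1) (c * cc q i α) := by
  simp [XX]

lemma XX_rel (hq1 : ∀ i, q i i = 1) (hq2 : ∀ i j, q i j = (q j i)⁻¹) (i j : Fin n) :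
    XX q i * XX q j = (q i j : k) • (XX q j * XX q i) := by
  refine Finsupp.lhom_ext fun α c => ?_
  simp only [Module.End.mul_apply, LinearMap.smul_apply, XX_single, Finsupp.smul_single]
  rw [add_right_comm]
  congr 1
  rw [cc_add, cc_add, cc_single, cc_single, smul_eq_mul]
  have key : (if j < i then q i j else 1) = q i j * (if i < j then q j i else 1) := by
    rcases lt_trichotomy i j with h | h | h
    · rw [if_neg h.not_gt, if_pos h, hq2 i j]; simp
    · subst h; simp [hq1]
    · rw [if_neg h.not_gt, if_pos h]; simp
  rw [key]
  push_cast
  ring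

variable (hq1 : ∀ i, q i i = 1) (hq2 : ∀ i j, q i j = (q j i)⁻¹)

/-- the regular representation on the monomial space -/
def rep : SkewPoly k q →ₐ[k] Module.End k ((Fin n →₀ ℕ) →₀ k) :=
  RingQuot.liftAlgHom k ⟨FreeAlgebra.lift k (XX q), by
    rintro _ _ ⟨i, j, rfl, rfl⟩
    simp only [map_mul, map_smul, FreeAlgebra.lift_ι_apply]
    exact XX_rel q hq1 hq2 i j⟩

lemma rep_x (i : Fin n) : rep q hq1 hq2 (skewVar k q i) = XX q i := by
  simp [rep, skewVar]

/-- coordinates with respect to monomials -/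
def Φ : SkewPoly k q →ₗ[k] ((Fin n →₀ ℕ) →₀ k) :=
  (LinearMap.applyₗ (Finsupp.single 0 1)).comp (rep q hq1 hq2).toLinearMap

lemma Φ_apply (a : SkewPoly k q) : Φ q hq1 hq2 a = rep q hq1 hq2 a (Finsupp.single 0 1) := rfl

/-- exponent of a word -/
def cnt (w : List (Fin n)) : Fin n →₀ ℕ := (w.map (fun i => Finsupp.single i 1)).sum

lemma cnt_cons (i : Fin n) (w : List (Fin n)) : cnt (i :: w) = Finsupp.single i 1 + cnt w := by
  simp [cnt]

lemma cnt_append (v w : List (Fin n)) : cnt (v ++ w) = cnt v + cnt w := by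
  simp [cnt]

lemma cnt_apply (w : List (Fin n)) (j : Fin n) : cnt w j = w.count j := by
  induction w with
  | nil => simp [cnt]
  | cons a w ih =>
    rw [cnt_cons, List.count_cons, Finsupp.add_apply, ih, Finsupp.single_apply, add_comm]
    simp

lemma cnt_degree (w : List (Fin n)) : (cnt w).degree = w.length := by
  induction w with
  | nil => simp [cnt]
  | cons a w ih => rw [cnt_cons, map_add, ih]; simp [add_comm]

lemma exists_word (α : Fin n →₀ ℕ) : ∃ w : List (Fin n), cnt w = α := by
  refine ⟨(Finsupp.toMultiset α).toList, ?_⟩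
  ext j
  rw [cnt_apply, ← Multiset.coe_count, Multiset.coe_toList, Finsupp.count_toMultiset]

/-- a chosen word for an exponent -/
def wo (α : Fin n →₀ ℕ) : List (Fin n) := (exists_word α).choose

lemma cnt_wo (α : Fin n →₀ ℕ) : cnt (wo α) = α := (exists_word α).choose_spec

lemma perm_of_cnt {v w : List (Fin n)} (h : cnt v = cnt w) : v.Perm w := by
  rw [List.perm_iff_count]
  intro a
  rw [← cnt_apply, ← cnt_apply, h]

lemma wp_perm {v w : List (Fin n)} (h : v.Perm w) : ∃ c : kˣ, wp q v = (c : k) • wp q w := by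
  induction h with
  | nil => exact ⟨1, by simp⟩
  | cons a _ ih =>
    obtain ⟨c, hc⟩ := ih
    exact ⟨c, by rw [wp_cons, hc, mul_smul_comm, wp_cons]⟩
  | swap a b l =>
    refine ⟨q b a, ?_⟩
    simp only [wp_cons]
    rw [← mul_assoc, rel, smul_mul_assoc, mul_assoc]
  | trans _ _ h1 h2 =>
    obtain ⟨c, hc⟩ := h1
    obtain ⟨c', hc'⟩ := h2
    exact ⟨c * c', by rw [hc, hc', smul_smul, Units.val_mul]⟩

/-- coefficient of a word -/
def uu : List (Fin n) → kˣ
  | [] => 1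
  | i :: w => uu w * cc q i (cnt w)

lemma Φ_wp (w : List (Fin n)) : Φ q hq1 hq2 (wp q w) = Finsupp.single (cnt w) (uu q w : k) := by
  induction w with
  | nil => simp [Φ_apply, uu, cnt]
  | cons i w ih =>
    rw [Φ_apply] at ih ⊢
    rw [wp_cons, map_mul, Module.End.mul_apply, ih, rep_x, XX_single, cnt_cons, add_comm]
    simp [uu]

/-- normalized monomials -/
def mm (α : Fin n →₀ ℕ) : SkewPoly k q := ((uu q (wo α))⁻¹ : kˣ).val • wp q (wo α)

lemma Φ_mm (α : Fin n →₀ ℕ) : Φ q hq1 hq2 (mm q α) = Finsupp.single α 1 := by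
  rw [mm, map_smul, Φ_wp, cnt_wo, Finsupp.smul_single, smul_eq_mul, ← Units.val_mul]
  simp

include hq1 hq2 in
lemma wp_eq (w : List (Fin n)) : wp q w = (uu q w : k) • mm q (cnt w) := by
  obtain ⟨c, hc⟩ := wp_perm q (perm_of_cnt (cnt_wo (cnt w)).symm)
  have h1 : wp q w = ((c : k) * uu q (wo (cnt w))) • mm q (cnt w) := by
    rw [mm, smul_smul, mul_assoc, ← Units.val_mul]; simp [hc]
  have h2 := congrArg (Φ q hq1 hq2) h1
  rw [Φ_wp, map_smul, Φ_mm] at h2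
  have h3 := DFunLike.congr_fun h2 (cnt w)
  simp at h3
  rw [h1, h3]

lemma expand (a : SkewPoly k q) : a = (Φ q hq1 hq2 a).sum (fun α c => c • mm q α) := by
  induction a using word_induction with
  | h0 => simp
  | hw w => rw [Φ_wp, Finsupp.sum_single_index (by simp)]; exact wp_eq q hq1 hq2 w
  | hadd a b ha hb =>
    rw [map_add, Finsupp.sum_add_index' (by simp) (by intros; rw [add_smul])]
    rw [← ha, ← hb]
  | hs c a ha =>
    rw [map_smul, Finsupp.sum_smul_index (by simp)]
    simp only [mul_smul]
    rw [← Finsupp.smul_sum, ← ha]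

/-- structure constants -/
def nu (δ α : Fin n →₀ ℕ) : kˣ := (uu q (wo δ))⁻¹ * (uu q (wo α))⁻¹ * uu q (wo δ ++ wo α)

lemma Φ_mm_mul (δ α : Fin n →₀ ℕ) :
    Φ q hq1 hq2 (mm q δ * mm q α) = Finsupp.single (δ + α) (nu q δ α : k) := by
  rw [mm, mm, smul_mul_smul_comm, ← wp_append, map_smul, Φ_wp, cnt_append, cnt_wo, cnt_wo,
    Finsupp.smul_single]
  simp [nu]

lemma Φ_mul (a b : SkewPoly k q) (γ : Fin n →₀ ℕ) :
    Φ q hq1 hq2 (a * b) γ = ∑ δ ∈ (Φ q hq1 hq2 a).support, ∑ α ∈ (Φ q hq1 hq2 b).support,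
      if δ + α = γ then Φ q hq1 hq2 a δ * Φ q hq1 hq2 b α * nu q δ α else 0 := by
  conv_lhs => rw [expand q hq1 hq2 a, expand q hq1 hq2 b]
  rw [Finsupp.sum, Finsupp.sum, Finset.sum_mul_sum, map_sum, Finsupp.finsetSum_apply]
  refine Finset.sum_congr rfl fun δ _ => ?_
  rw [map_sum, Finsupp.finsetSum_apply]
  refine Finset.sum_congr rfl fun α _ => ?_
  rw [smul_mul_smul_comm, map_smul, Φ_mm_mul, Finsupp.smul_apply, Finsupp.single_apply]
  split_ifs <;> simp

lemma Φ_mul_unique (a b : SkewPoly k q) (δ₀ α₀ : Fin n →₀ ℕ)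
    (h : ∀ δ α, Φ q hq1 hq2 a δ ≠ 0 → Φ q hq1 hq2 b α ≠ 0 → δ + α = δ₀ + α₀ → δ = δ₀ ∧ α = α₀) :
    Φ q hq1 hq2 (a * b) (δ₀ + α₀) = Φ q hq1 hq2 a δ₀ * Φ q hq1 hq2 b α₀ * nu q δ₀ α₀ := by
  rw [Φ_mul, Finset.sum_eq_single δ₀]
  · rw [Finset.sum_eq_single α₀]
    · simp
    · intro α hα hne
      rw [if_neg]
      intro he
      exact hne (by simpa using he)
    · intro hα; simp at hα; simp [hα]
  · intro δ hδ hne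
    refine Finset.sum_eq_zero fun α hα => ?_
    rw [if_neg]
    intro he
    exact hne (h δ α (by simpa using hδ) (by simpa using hα) he).1
  · intro hδ; simp at hδ; simp [hδ]

lemma Φ_mul_ne {a b : SkewPoly k q} {γ : Fin n →₀ ℕ} (h : Φ q hq1 hq2 (a * b) γ ≠ 0) :
    ∃ δ α, Φ q hq1 hq2 a δ ≠ 0 ∧ Φ q hq1 hq2 b α ≠ 0 ∧ δ + α = γ := by
  rw [Φ_mul] at h
  obtain ⟨δ, hδ, h⟩ := Finset.exists_ne_zero_of_sum_ne_zero h
  obtain ⟨α, hα, h⟩ := Finset.exists_ne_zero_of_sum_ne_zero h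
  refine ⟨δ, α, by simpa using hδ, by simpa using hα, ?_⟩
  by_contra hc
  simp [hc] at h

lemma Φ_x (i : Fin n) : Φ q hq1 hq2 (skewVar k q i) = Finsupp.single (Finsupp.single i 1) 1 := by
  rw [← wp_single, Φ_wp]
  simp [cnt, uu, cc]

include hq1 hq2 in
lemma mm_single (i : Fin n) : mm q (Finsupp.single i 1) = skewVar k q i := by
  have h1 := expand q hq1 hq2 (skewVar k q i)
  rw [Φ_x, Finsupp.sum_single_index (by simp), one_smul] at h1
  exact h1.symm

include hq1 hq2 in
lemma nu_col (α : Fin n →₀ ℕ) (i : Fin n) : (nu q α (Finsupp.single i 1) : k) =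
    col q (wo α) i * nu q (Finsupp.single i 1) α := by
  have h1 : mm q α * skewVar k q i = (col q (wo α) i : k) • (skewVar k q i * mm q α) := by
    rw [mm, smul_mul_assoc, wp_mul_x, mul_smul_comm, smul_comm]
  rw [← mm_single q hq1 hq2 i] at h1
  have h2 := congrArg (Φ q hq1 hq2) h1
  rw [map_smul, Φ_mm_mul, Φ_mm_mul, add_comm α] at h2
  have h3 := DFunLike.congr_fun h2 (Finsupp.single i 1 + α)
  simpa using h3

lemma Φ_wordSpan {d : ℕ} {f : SkewPoly k q} (hf : f ∈ wordSpan k q d) (α : Fin n →₀ ℕ)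
    (hα : Φ q hq1 hq2 f α ≠ 0) : α.degree = d := by
  contrapose! hα
  induction hf using Submodule.span_induction with
  | mem x h =>
    obtain ⟨w, hw, rfl⟩ := h
    change Φ q hq1 hq2 (wp q w) α = 0
    rw [Φ_wp, Finsupp.single_apply, if_neg]
    rintro rfl
    exact hα ((cnt_degree w).trans hw)
  | zero => simp
  | add x y _ _ hx hy => simp [hx, hy]
  | smul c x _ hx => simp [hx]

include hq1 hq2 in
/-- normal homogeneous elements are colour-homogeneous -/
lemma normal_CW {d : ℕ} {f : SkewPoly k q} (hf : f ∈ wordSpan k q d) (hf0 : f ≠ 0)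
    (hn : ∀ i, ∃ b, f * skewVar k q i = b * f) : ∃ w0, f ∈ CW q d w0 := by
  have hne : Φ q hq1 hq2 f ≠ 0 := by
    intro h
    apply hf0
    rw [expand q hq1 hq2 f, h, Finsupp.sum_zero_index]
  obtain ⟨α₀, hα₀⟩ := Finsupp.ne_iff.1 hne
  rw [Finsupp.zero_apply] at hα₀
  have hcol : ∀ i, ∃ b : k, ∀ α, Φ q hq1 hq2 f α ≠ 0 → (col q (wo α) i : k) = b := by
    intro i
    obtain ⟨b, hb⟩ := hn i
    have hxf : ∀ δ α, Φ q hq1 hq2 b δ ≠ 0 → Φ q hq1 hq2 f α ≠ 0 → ∀ α' l,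
        Φ q hq1 hq2 f α' ≠ 0 → δ + α = Finsupp.single l 1 + α' → ∃ p, δ = Finsupp.single p 1 := by
      intro δ α _ h2 α' l h3 h4
      have := congrArg Finsupp.degree h4
      rw [map_add, map_add, Φ_wordSpan q hq1 hq2 hf α h2, Φ_wordSpan q hq1 hq2 hf α' h3] at this
      have h5 : δ.degree = 1 := by simpa using this
      have h6 := cnt_degree (wo δ)
      rw [cnt_wo, h5] at h6
      obtain ⟨p, hp⟩ := List.length_eq_one_iff.1 h6.symm
      refine ⟨p, ?_⟩
      rw [← cnt_wo δ, hp]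
      simp [cnt]
    have hzero : ∀ l, l ≠ i → Φ q hq1 hq2 b (Finsupp.single l 1) = 0 := by
      intro l hl
      obtain ⟨α, hα, hmax⟩ := Finset.exists_max_image (Φ q hq1 hq2 f).support (fun α => α l)
        ⟨α₀, by simpa using hα₀⟩
      have hα' : Φ q hq1 hq2 f α ≠ 0 := by simpa using hα
      have h1 := Φ_mul_unique q hq1 hq2 b f (Finsupp.single l 1) α (by
        intro δ α' hδ hα'' he
        obtain ⟨p, rfl⟩ := hxf δ α' hδ hα'' α l hα' he
        by_cases hp : p = l
        · subst hp
          exact ⟨rfl, by simpa using he⟩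
        · exfalso
          have h6 := DFunLike.congr_fun he l
          have h7 := hmax α' (by simpa using hα'')
          simp [Finsupp.single_apply, hp] at h6
          omega)
      have h2 : Φ q hq1 hq2 (f * skewVar k q i) (Finsupp.single l 1 + α) = 0 := by
        by_contra hc
        obtain ⟨δ, β, h3, h4, h5⟩ := Φ_mul_ne q hq1 hq2 hc
        rw [Φ_x] at h4
        have h6 : Finsupp.single i 1 = β := by
          by_contra h; simp [Finsupp.single_apply, h] at h4
        subst h6
        have h6 := DFunLike.congr_fun h5 l
        have h7 := hmax δ (by simpa using h3)
        simp [Finsupp.single_apply, hl.symm] at h6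
        omega
      rw [hb, h1] at h2
      simpa [hα'] using h2
    refine ⟨Φ q hq1 hq2 b (Finsupp.single i 1), fun α hα => ?_⟩
    have h1 := Φ_mul_unique q hq1 hq2 b f (Finsupp.single i 1) α (by
      intro δ α' hδ hα' he
      obtain ⟨p, rfl⟩ := hxf δ α' hδ hα' α i hα he
      have hp : p = i := by
        by_contra hp
        exact hδ (hzero p hp)
      subst hp
      exact ⟨rfl, by simpa using he⟩)
    have h2 := Φ_mul_unique q hq1 hq2 f (skewVar k q i) α (Finsupp.single i 1) (by
      intro δ β _ h4 he
      rw [Φ_x] at h4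
      have h6 : Finsupp.single i 1 = β := by
        by_contra h; simp [Finsupp.single_apply, h] at h4
      subst h6
      exact ⟨by simpa using he, rfl⟩)
    rw [hb, add_comm, h1, Φ_x, nu_col q hq1 hq2] at h2
    simp only [Finsupp.single_eq_same, mul_one] at h2
    have h3 : (Φ q hq1 hq2 f α * (nu q (Finsupp.single i 1) α : k)) *
        (Φ q hq1 hq2 b (Finsupp.single i 1) - col q (wo α) i) = 0 := by
      linear_combination h2
    have h4 : Φ q hq1 hq2 f α * (nu q (Finsupp.single i 1) α : k) ≠ 0 :=
      mul_ne_zero hα (Units.ne_zero _)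
    exact (sub_eq_zero.1 ((mul_eq_zero.1 h3).resolve_left h4)).symm
  refine ⟨wo α₀, ?_⟩
  rw [expand q hq1 hq2 f, Finsupp.sum]
  refine Submodule.sum_mem _ fun α hα => Submodule.smul_mem _ _ ?_
  have hα' : Φ q hq1 hq2 f α ≠ 0 := by simpa using hα
  rw [mm]
  refine Submodule.smul_mem _ _ (Submodule.subset_span ⟨wo α, ?_, ?_, rfl⟩)
  · rw [← cnt_degree, cnt_wo, Φ_wordSpan q hq1 hq2 hf α hα']
  · funext i
    obtain ⟨b, hb⟩ := hcol i
    exact Units.ext ((hb α hα').trans (hb α₀ hα₀).symm)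

/-- left ideal of the first variables -/
def LL (p : ℕ) : Ideal (SkewPoly k q) := Ideal.span {y | ∃ i : Fin n, i.val < p ∧ y = skewVar k q i}

lemma mem_LL (p : ℕ) (a : SkewPoly k q) :
    a ∈ LL q p ↔ ∀ α, Φ q hq1 hq2 a α ≠ 0 → ∃ i : Fin n, i.val < p ∧ α i ≠ 0 := by
  constructor
  · intro h
    induction h using Submodule.span_induction with
    | mem x h =>
      obtain ⟨i, hi, rfl⟩ := h
      intro α hα
      refine ⟨i, hi, ?_⟩
      rw [Φ_x, Finsupp.single_apply] at hα
      have : Finsupp.single i 1 = α := by by_contra h; simp [h] at hα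
      simp [← this]
    | zero => simp
    | add x y _ _ hx hy =>
      intro α hα
      by_cases h : Φ q hq1 hq2 x α = 0
      · apply hy; simpa [h] using hα
      · exact hx α h
    | smul c x _ hx =>
      intro α hα
      obtain ⟨δ, β, _, h2, rfl⟩ := Φ_mul_ne q hq1 hq2 hα
      obtain ⟨i, hi, h⟩ := hx β h2
      exact ⟨i, hi, by simp [h]⟩
  · intro h
    rw [expand q hq1 hq2 a, Finsupp.sum]
    refine Ideal.sum_mem _ fun α hα => ?_
    obtain ⟨i, hi, hαi⟩ := h α (by simpa using hα)
    have h1 : α - Finsupp.single i 1 + Finsupp.single i 1 = α := by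
      apply tsub_add_cancel_of_le
      simpa [Nat.one_le_iff_ne_zero] using hαi
    have hp : (wo α).Perm (wo (α - Finsupp.single i 1) ++ [i]) := by
      apply perm_of_cnt
      rw [cnt_append, cnt_wo, cnt_wo]
      simpa [cnt] using h1.symm
    obtain ⟨c, hc⟩ := wp_perm q hp
    rw [mm, hc, wp_append, wp_single, Algebra.smul_def, Algebra.smul_def, Algebra.smul_def]
    refine Ideal.mul_mem_left _ _ (Ideal.mul_mem_left _ _ (Ideal.mul_mem_left _ _
      (Ideal.mul_mem_left _ _ (Ideal.subset_span ⟨i, hi, rfl⟩))))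

include hq1 hq2 in
lemma LL_reg (p : Fin n) (r : SkewPoly k q) (h : r * skewVar k q p ∈ LL q p.val) :
    r ∈ LL q p.val := by
  rw [mem_LL q hq1 hq2] at h ⊢
  intro α hα
  have h2 := Φ_mul_unique q hq1 hq2 r (skewVar k q p) α (Finsupp.single p 1) (by
      intro δ β _ h4 he
      rw [Φ_x] at h4
      have h6 : Finsupp.single p 1 = β := by
        by_contra h; simp [Finsupp.single_apply, h] at h4
      subst h6
      exact ⟨by simpa using he, rfl⟩)
  rw [Φ_x] at h2
  obtain ⟨i, hi, h3⟩ := h (α + Finsupp.single p 1) (by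
    rw [h2]; simpa using hα)
  refine ⟨i, hi, ?_⟩
  have : p ≠ i := by rintro rfl; exact lt_irrefl _ hi
  simpa [Finsupp.single_apply, this] using h3

lemma sub_aug_mem (aug : SkewPoly k q →ₐ[k] k) (haug : ∀ i, aug (skewVar k q i) = 0)
    (a : SkewPoly k q) : a - algebraMap k _ (aug a) ∈ LL q n := by
  induction a using word_induction with
  | h0 => simp
  | hw w =>
    rcases List.eq_nil_or_concat w with rfl | ⟨v, i, rfl⟩
    · simp
    · rw [List.concat_eq_append, wp_append, wp_single, map_mul, haug]
      simp only [mul_zero, map_zero, sub_zero]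
      exact Ideal.mul_mem_left _ _ (Ideal.subset_span ⟨i, i.2, rfl⟩)
  | hadd a b ha hb =>
    have := add_mem ha hb
    rw [map_add, map_add]
    convert this using 1; abel
  | hs c a ha =>
    have := Ideal.mul_mem_left _ (algebraMap k _ c) ha
    rw [mul_sub, ← Algebra.smul_def, ← map_mul] at this
    simpa using this

end MonPart
end SkewCI


namespace SkewCI

section AlgPart

variable {k : Type} [Field k] {n : ℕ} (q : Fin n → Fin n → kˣ)
  {A : Type} [Ring A] [Algebra k A] (ρ η : Fin n → A)

/-- right multiplication by a word -/
def rword : List (Fin n) → A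
  | [] => 1
  | l :: w => rword w * ρ l

/-- the homotopy attached to a word -/
def zw : List (Fin n) → A
  | [] => 0
  | l :: w => rword ρ w * η l

/-- the relations between the operators -/
structure Rels (J : Fin n → Prop) (d : A) : Prop where
  rr : ∀ i l, ρ i * ρ l = (q l i : k) • (ρ l * ρ i)
  dr : ∀ i, d * ρ i = ρ i * d
  de : ∀ i, J i → d * η i + η i * d = ρ i
  ee : ∀ i l, J i → J l → η i * η l = -((q l i : k) • (η l * η i))
  e2 : ∀ i, J i → η i * η i = 0
  er : ∀ i l, J i → η i * ρ l = (q l i : k) • (ρ l * η i)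

variable {q ρ η} {d : A} (H : Rels q ρ η (fun _ => True) d)

include H

lemma Rels.rw_d (w : List (Fin n)) : d * rword ρ w = rword ρ w * d := by
  induction w with
  | nil => simp [rword]
  | cons l w ih => rw [rword, ← mul_assoc, ih, mul_assoc, H.dr, mul_assoc]

lemma Rels.rw_r (w : List (Fin n)) (i : Fin n) :
    ρ i * rword ρ w = (col q w i : k) • (rword ρ w * ρ i) := by
  induction w with
  | nil => simp [rword]
  | cons l w ih =>
    rw [rword, ← mul_assoc, ih, smul_mul_assoc, mul_assoc, H.rr, mul_smul_comm, smul_smul,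
      mul_assoc, col_cons, Units.val_mul, mul_comm (q l i : k)]

lemma Rels.rw_e (w : List (Fin n)) (i : Fin n) :
    η i * rword ρ w = (col q w i : k) • (rword ρ w * η i) := by
  induction w with
  | nil => simp [rword]
  | cons l w ih =>
    rw [rword, ← mul_assoc, ih, smul_mul_assoc, mul_assoc, H.er _ _ trivial, mul_smul_comm, smul_smul,
      mul_assoc, col_cons, Units.val_mul, mul_comm (q l i : k)]

lemma Rels.z_d (l : Fin n) (w : List (Fin n)) :
    d * zw ρ η (l :: w) + zw ρ η (l :: w) * d = rword ρ (l :: w) := by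
  rw [zw, ← mul_assoc, H.rw_d, rword, mul_assoc, mul_assoc, ← mul_add, H.de _ trivial]

lemma Rels.re (hq2 : ∀ i j, q i j = (q j i)⁻¹) (i l : Fin n) :
    ρ i * η l = (q l i : k) • (η l * ρ i) := by
  rw [H.er _ _ trivial, smul_smul, ← Units.val_mul, hq2 i l]; simp

lemma Rels.z_r (hq2 : ∀ i j, q i j = (q j i)⁻¹) (w : List (Fin n)) (i : Fin n) :
    ρ i * zw ρ η w = (col q w i : k) • (zw ρ η w * ρ i) := by
  cases w with
  | nil => simp [zw]
  | cons l w =>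
    rw [zw, ← mul_assoc, H.rw_r, smul_mul_assoc, mul_assoc, H.re hq2, mul_smul_comm, smul_smul,
      mul_assoc, col_cons, Units.val_mul, mul_comm (q l i : k)]

lemma Rels.z_e (w : List (Fin n)) (i : Fin n) :
    η i * zw ρ η w = -((col q w i : k) • (zw ρ η w * η i)) := by
  cases w with
  | nil => simp [zw]
  | cons l w =>
    rw [zw, ← mul_assoc, H.rw_e, smul_mul_assoc, mul_assoc, H.ee _ _ trivial trivial, mul_neg,
      mul_smul_comm, smul_neg, smul_smul,
      mul_assoc, col_cons, Units.val_mul, mul_comm (q l i : k)]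

lemma Rels.rw_z (hq2 : ∀ i j, q i j = (q j i)⁻¹) (w u : List (Fin n)) :
    rword ρ u * zw ρ η w = (BB q w u : k) • (zw ρ η w * rword ρ u) := by
  induction u with
  | nil => simp [rword, BB]
  | cons l u ih =>
    rw [rword, mul_assoc, H.z_r hq2, mul_smul_comm, ← mul_assoc, ih, smul_mul_assoc, smul_smul,
      mul_assoc]
    simp [BB]

lemma Rels.z_z (hq2 : ∀ i j, q i j = (q j i)⁻¹) (w u : List (Fin n)) :
    zw ρ η u * zw ρ η w = -((BB q w u : k) • (zw ρ η w * zw ρ η u)) := by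
  cases u with
  | nil => simp [zw]
  | cons l u =>
    rw [zw.eq_2 ρ η l u, mul_assoc, H.z_e, mul_neg, mul_smul_comm, ← mul_assoc, H.rw_z hq2, smul_mul_assoc,
      smul_smul, mul_assoc]
    simp [BB]

lemma Rels.z_sq (w : List (Fin n)) : zw ρ η w * zw ρ η w = 0 := by
  cases w with
  | nil => simp [zw]
  | cons l w =>
    rw [zw, mul_assoc, ← mul_assoc (η l), H.rw_e, smul_mul_assoc, mul_assoc, H.e2 _ trivial]
    simp

omit H
/-- the span of the homotopies -/
def ZZ (q : Fin n → Fin n → kˣ) (ρ η : Fin n → A) (D : ℕ) (w0 : List (Fin n)) : Submodule k A :=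
  Submodule.span k {m | ∃ w : List (Fin n), w.length = D ∧ col q w = col q w0 ∧ m = zw ρ η w}

include H

lemma Rels.ZZ_r (hq2 : ∀ i j, q i j = (q j i)⁻¹) {D : ℕ} {w0 : List (Fin n)} {s : A}
    (hs : s ∈ ZZ q ρ η D w0) (i : Fin n) : ρ i * s = (col q w0 i : k) • (s * ρ i) := by
  induction hs using Submodule.span_induction with
  | mem x h => obtain ⟨w, -, h, rfl⟩ := h; rw [H.z_r hq2, h]
  | zero => simp
  | add x y _ _ hx hy => rw [mul_add, hx, hy, add_mul, smul_add]
  | smul c x _ hx => rw [mul_smul_comm, hx, smul_mul_assoc, smul_comm]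

lemma Rels.ZZ_e {D : ℕ} {w0 : List (Fin n)} {s : A}
    (hs : s ∈ ZZ q ρ η D w0) (i : Fin n) : η i * s = -((col q w0 i : k) • (s * η i)) := by
  induction hs using Submodule.span_induction with
  | mem x h => obtain ⟨w, -, h, rfl⟩ := h; rw [H.z_e, h]
  | zero => simp
  | add x y _ _ hx hy => rw [mul_add, hx, hy, add_mul, smul_add, neg_add]
  | smul c x _ hx => rw [mul_smul_comm, hx, smul_mul_assoc, smul_comm, smul_neg]

lemma Rels.ZZ_sq (hq1 : ∀ i, q i i = 1) (hq2 : ∀ i j, q i j = (q j i)⁻¹) {D : ℕ}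
    {w0 : List (Fin n)} {s : A} (hs : s ∈ ZZ q ρ η D w0) : s * s = 0 := by
  have hanti : ∀ s t : A, s ∈ ZZ q ρ η D w0 → t ∈ ZZ q ρ η D w0 → s * t + t * s = 0 := by
    intro s t hs ht
    induction hs using Submodule.span_induction with
    | mem x h =>
      induction ht using Submodule.span_induction with
      | mem y h' =>
        obtain ⟨w, -, h, rfl⟩ := h
        obtain ⟨u, -, h', rfl⟩ := h'
        rw [H.z_z hq2]
        have : BB q u w = 1 := by
          rw [← BB_self q hq1 hq2 w, BB, BB, h, h']
        rw [this]; simp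
      | zero => simp
      | add y z _ _ hy hz =>
        rw [mul_add, add_mul]; rw [← add_zero (0 : A)]; nth_rewrite 1 [← hy]; rw [← hz]; abel
      | smul c y _ hy => rw [mul_smul_comm, smul_mul_assoc, ← smul_add, hy, smul_zero]
    | zero => simp
    | add y z _ _ hy hz =>
      rw [mul_add, add_mul]; rw [← add_zero (0 : A)]; nth_rewrite 1 [← hy]; rw [← hz]; abel
    | smul c y _ hy => rw [mul_smul_comm, smul_mul_assoc, ← smul_add, hy, smul_zero]
  induction hs using Submodule.span_induction with
  | mem x h => obtain ⟨w, -, h, rfl⟩ := h; exact H.z_sq w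
  | zero => simp
  | add x y hx' hy' hx hy =>
    have := hanti x y hx' hy'
    rw [mul_add, add_mul, add_mul, hx, hy, zero_add, add_zero, add_comm, this]
  | smul c x _ hx => rw [mul_smul_comm, smul_mul_assoc, hx]; simp

end AlgPart
end SkewCI


namespace SkewCI

section CxPart

set_option linter.unusedSectionVars false

variable {k : Type} [Field k] {n : ℕ} {q : Fin n → Fin n → kˣ}
  {ι F : Type} [AddCommGroup F] [Module (SkewPoly k q) F] [Module k F]
  [IsScalarTower k (SkewPoly k q) F]

/-- homogeneous elements of homological degree `i` -/
def Gr (b : Module.Basis ι (SkewPoly k q) F) (deg : ι → ℕ) (i : ℤ) :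
    Submodule (SkewPoly k q) F where
  carrier := {v | ∀ e, b.repr v e ≠ 0 → (deg e : ℤ) = i}
  add_mem' := by
    intro v w hv hw e he
    by_cases h : b.repr v e = 0
    · apply hw; simpa [h] using he
    · exact hv e h
  zero_mem' := by intro e he; simp at he
  smul_mem' := by
    intro a v hv e he
    apply hv
    intro h
    simp [h] at he

lemma mem_Gr {b : Module.Basis ι (SkewPoly k q) F} {deg : ι → ℕ} {i : ℤ} {v : F} :
    v ∈ Gr b deg i ↔ ∀ e, b.repr v e ≠ 0 → (deg e : ℤ) = i := Iff.rfl

/-- vectors with coordinates in an ideal -/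
def IF (b : Module.Basis ι (SkewPoly k q) F) (I : Ideal (SkewPoly k q)) :
    Submodule (SkewPoly k q) F where
  carrier := {v | ∀ e, b.repr v e ∈ I}
  add_mem' := by
    intro v w hv hw e
    rw [map_add, Finsupp.add_apply]
    exact add_mem (hv e) (hw e)
  zero_mem' := by intro e; simp
  smul_mem' := by
    intro a v hv e
    rw [map_smul, Finsupp.smul_apply, smul_eq_mul]
    exact I.mul_mem_left _ (hv e)

lemma mem_IF {b : Module.Basis ι (SkewPoly k q) F} {I : Ideal (SkewPoly k q)} {v : F} :
    v ∈ IF b I ↔ ∀ e, b.repr v e ∈ I := Iff.rfl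

lemma IF_stable (b : Module.Basis ι (SkewPoly k q) F) (I : Ideal (SkewPoly k q)) [I.IsTwoSided]
    (T : Module.End (SkewPoly k q) F) {v : F} (hv : v ∈ IF b I) : T v ∈ IF b I := by
  intro e
  rw [← b.linearCombination_repr v, Finsupp.linearCombination_apply, Finsupp.sum, map_sum, map_sum,
    Finsupp.finsetSum_apply]
  refine Ideal.sum_mem _ fun e' _ => ?_
  rw [map_smul, map_smul, Finsupp.smul_apply, smul_eq_mul]
  exact I.mul_mem_right _ (hv e')

lemma IF_ksmul {b : Module.Basis ι (SkewPoly k q) F} {I : Ideal (SkewPoly k q)} (c : k) {v : F}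
    (hv : v ∈ IF b I) : c • v ∈ IF b I := by
  rw [← algebraMap_smul (SkewPoly k q) c v]
  exact Submodule.smul_mem _ _ hv

lemma repr_ksmul (b : Module.Basis ι (SkewPoly k q) F) (c : k) (v : F) (e : ι) :
    b.repr (c • v) e = c • b.repr v e := by
  rw [← algebraMap_smul (SkewPoly k q) c v, map_smul, Finsupp.smul_apply, algebraMap_smul]

lemma Gr_ksmul {b : Module.Basis ι (SkewPoly k q) F} {deg : ι → ℕ} {i : ℤ} (c : k) {v : F}
    (hv : v ∈ Gr b deg i) : c • v ∈ Gr b deg i := by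
  rw [← algebraMap_smul (SkewPoly k q) c v]
  exact Submodule.smul_mem _ _ hv

/-- The structure of the partial acyclic closure. -/
structure Cx (aug : SkewPoly k q →ₐ[k] k) (J : Fin n → Prop)
    (b : Module.Basis ι (SkewPoly k q) F) (deg : ι → ℕ) (d : Module.End (SkewPoly k q) F)
    (ρ η : Fin n → Module.End (SkewPoly k q) F) (χ : ι → Fin n → kˣ) (o : ι) : Prop where
  rels : Rels q ρ η J d
  rb : ∀ i e, ρ i (b e) = (χ e i : k) • (skewVar k q i • b e)
  good : ∀ e, Good q (χ e)
  deg0 : ∀ e, deg e = 0 ↔ e = o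
  chio : χ o = 1
  dgr : ∀ i v, v ∈ Gr b deg i → d v ∈ Gr b deg (i - 1)
  egr : ∀ l, J l → ∀ i v, v ∈ Gr b deg i → η l v ∈ Gr b deg (i + 1)
  min : ∀ v e, aug (b.repr (d v) e) = 0

namespace Cx

variable {aug : SkewPoly k q →ₐ[k] k} {J : Fin n → Prop}
    {b : Module.Basis ι (SkewPoly k q) F} {deg : ι → ℕ} {d : Module.End (SkewPoly k q) F}
    {ρ η : Fin n → Module.End (SkewPoly k q) F} {χ : ι → Fin n → kˣ} {o : ι}
    (C : Cx aug J b deg d ρ η χ o)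

lemma diag {T : Module.End (SkewPoly k q) F} {f : SkewPoly k q} {β : ι → k}
    (hT : ∀ e, T (b e) = β e • (f • b e)) (v : F) (e : ι) :
    b.repr (T v) e = β e • (b.repr v e * f) := by
  classical
  conv_lhs => rw [← b.linearCombination_repr v, Finsupp.linearCombination_apply, Finsupp.sum,
    map_sum, map_sum, Finsupp.finsetSum_apply]
  have h : ∀ e', b.repr (T (b.repr v e' • b e')) e =
      if e' = e then β e' • (b.repr v e' * f) else 0 := by
    intro e'
    rw [map_smul, hT, map_smul, Finsupp.smul_apply, repr_ksmul, map_smul, Finsupp.smul_apply,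
      b.repr_self, Finsupp.single_apply]
    split_ifs <;> simp
  simp_rw [h]
  rw [Finset.sum_ite_eq' ]
  split_ifs with h1
  · rfl
  · simp at h1; simp [h1]

include C

lemma r_repr (i : Fin n) (v : F) (e : ι) :
    b.repr (ρ i v) e = (χ e i : k) • (b.repr v e * skewVar k q i) :=
  diag (β := fun e => (χ e i : k)) (C.rb i) v e

lemma rgr (l : Fin n) (i : ℤ) (v : F) (hv : v ∈ Gr b deg i) : ρ l v ∈ Gr b deg i := by
  intro e he
  apply hv
  intro h
  rw [C.r_repr, h] at he
  simp at he

lemma bo_gr : b o ∈ Gr b deg 0 := by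
  classical
  intro e he
  rw [b.repr_self, Finsupp.single_apply] at he
  have : o = e := by by_contra h; simp [h] at he
  subst this
  exact_mod_cast (C.deg0 o).2 rfl

lemma d_bo : d (b o) = 0 := by
  have h := C.dgr 0 _ C.bo_gr
  apply b.repr.injective
  ext e
  rw [map_zero, Finsupp.zero_apply]
  by_contra he
  have := h e he
  omega

end Cx

section Koszul

variable (d : Module.End (SkewPoly k q) F)
    (ρ η : Fin n → Module.End (SkewPoly k q) F) (χ : ι → Fin n → kˣ)

/-- new differential -/
def kd (p : Fin n) : Module.End (SkewPoly k q) (F × F) :=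
  LinearMap.prod (d ∘ₗ LinearMap.fst _ _ _ + ρ p ∘ₗ LinearMap.snd _ _ _)
    (-(d ∘ₗ LinearMap.snd _ _ _))

lemma kd_apply (p : Fin n) (v : F × F) : kd d ρ p v = (d v.1 + ρ p v.2, -d v.2) := rfl

/-- new right multiplications -/
def kr (p : Fin n) (i : Fin n) : Module.End (SkewPoly k q) (F × F) :=
  LinearMap.prodMap (ρ i) ((q p i : k) • ρ i)

lemma kr_apply (p i : Fin n) (v : F × F) : kr ρ p i v = (ρ i v.1, (q p i : k) • ρ i v.2) := rfl

/-- new exterior multiplications -/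
def ke (p : Fin n) (i : Fin n) : Module.End (SkewPoly k q) (F × F) :=
  if i = p then LinearMap.prod 0 (LinearMap.fst _ _ _) else
    LinearMap.prodMap (η i) (-((q p i : k) • η i))

lemma ke_self (p : Fin n) (v : F × F) : ke η p p v = (0, v.1) := by
  simp [ke]

lemma ke_ne {p i : Fin n} (h : i ≠ p) (v : F × F) :
    ke η p i v = (η i v.1, -((q p i : k) • η i v.2)) := by
  simp [ke, h]

/-- new weights -/
def kχ (q : Fin n → Fin n → kˣ) (χ : ι → Fin n → kˣ) (p : Fin n) : ι ⊕ ι → Fin n → kˣ := Sum.elim χ (fun e => χ e * q p)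

/-- new degrees -/
def kdeg (deg : ι → ℕ) : ι ⊕ ι → ℕ := Sum.elim deg (fun e => deg e + 1)

lemma mem_kGr {b : Module.Basis ι (SkewPoly k q) F} {deg : ι → ℕ} {i : ℤ} {v : F × F} :
    v ∈ Gr (b.prod b) (kdeg deg) i ↔ v.1 ∈ Gr b deg i ∧ v.2 ∈ Gr b deg (i - 1) := by
  simp only [mem_Gr, Sum.forall, kdeg, Sum.elim_inl, Sum.elim_inr, Module.Basis.prod_repr_inl,
    Module.Basis.prod_repr_inr, Nat.cast_add, Nat.cast_one, eq_sub_iff_add_eq]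

variable {aug : SkewPoly k q →ₐ[k] k} {J J' : Fin n → Prop} {d ρ η χ}
    {b : Module.Basis ι (SkewPoly k q) F} {deg : ι → ℕ} {o : ι}

lemma q_mul_q (hq2 : ∀ i j, q i j = (q j i)⁻¹) (i j : Fin n) : (q i j : k) * q j i = 1 := by
  rw [← Units.val_mul, hq2 i j]; simp

lemma Rels.app_rr (H : Rels q ρ η J d) (i l : Fin n) (v : F) :
    ρ i (ρ l v) = (q l i : k) • ρ l (ρ i v) := LinearMap.congr_fun (H.rr i l) v

lemma Rels.app_dr (H : Rels q ρ η J d) (i : Fin n) (v : F) :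
    d (ρ i v) = ρ i (d v) := LinearMap.congr_fun (H.dr i) v

lemma Rels.app_de (H : Rels q ρ η J d) (i : Fin n) (hi : J i) (v : F) :
    d (η i v) + η i (d v) = ρ i v := LinearMap.congr_fun (H.de i hi) v

lemma Rels.app_ee (H : Rels q ρ η J d) (i l : Fin n) (hi : J i) (hl : J l) (v : F) :
    η i (η l v) = -((q l i : k) • η l (η i v)) := LinearMap.congr_fun (H.ee i l hi hl) v

lemma Rels.app_e2 (H : Rels q ρ η J d) (i : Fin n) (hi : J i) (v : F) :
    η i (η i v) = 0 := LinearMap.congr_fun (H.e2 i hi) v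

lemma Rels.app_er (H : Rels q ρ η J d) (i l : Fin n) (hi : J i) (v : F) :
    η i (ρ l v) = (q l i : k) • ρ l (η i v) := LinearMap.congr_fun (H.er i l hi) v

lemma map_ksmul (T : Module.End (SkewPoly k q) F) (c : k) (v : F) : T (c • v) = c • T v := by
  rw [← algebraMap_smul (SkewPoly k q) c v, map_smul, algebraMap_smul]

lemma koszul_rels (hq1 : ∀ i, q i i = 1) (hq2 : ∀ i j, q i j = (q j i)⁻¹)
    (H : Rels q ρ η J d) (p : Fin n)
    (hJ : ∀ i, J' i → i ≠ p → J i) : Rels q (kr ρ p) (ke η p) J' (kd d ρ p) where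
  rr i l := by
    refine LinearMap.ext fun v => ?_
    simp only [Module.End.mul_apply, LinearMap.smul_apply, kr_apply, map_ksmul, H.app_rr i l,
      Prod.smul_mk]
    ext
    · rfl
    · simp only [smul_smul]; congr 1; ring
  dr i := by
    refine LinearMap.ext fun v => ?_
    simp only [Module.End.mul_apply, kr_apply, kd_apply, map_ksmul, H.app_dr, map_add, map_neg,
      H.app_rr i p, smul_neg]
  de i hi := by
    refine LinearMap.ext fun v => ?_
    by_cases h : i = p
    · subst h
      simp only [LinearMap.add_apply, Module.End.mul_apply, ke_self, kd_apply, kr_apply, hq1]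
      simp
    · have hi' := hJ i hi h
      simp only [LinearMap.add_apply, Module.End.mul_apply, ke_ne η h, kd_apply, kr_apply,
        map_add, map_neg, map_ksmul, H.app_er i p hi', Prod.mk_add_mk, ← H.app_de i hi']
      ext <;> simp
      abel
  ee i l hi hl := by
    refine LinearMap.ext fun v => ?_
    simp only [LinearMap.neg_apply, LinearMap.smul_apply, Module.End.mul_apply]
    by_cases h : i = p
    · subst h
      by_cases h' : l = i
      · subst h'
        simp [ke_self]
      · simp only [ke_self, ke_ne η h', map_zero, Prod.smul_mk, smul_neg, smul_smul, q_mul_q hq2]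
        simp
    · have hi' := hJ i hi h
      by_cases h' : l = p
      · subst h'
        simp only [ke_self, ke_ne η h, map_zero, Prod.smul_mk]
        simp
      · have hl' := hJ l hl h'
        simp only [ke_ne η h', ke_ne η h, map_neg, map_ksmul, H.app_ee i l hi' hl', Prod.smul_mk,
          Prod.neg_mk]
        ext
        · rfl
        · simp only [smul_smul, smul_neg, neg_neg]; congr 2; ring
  e2 i hi := by
    refine LinearMap.ext fun v => ?_
    simp only [LinearMap.zero_apply, Module.End.mul_apply]
    by_cases h : i = p
    · subst h; simp [ke_self]
    · have hi' := hJ i hi h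
      simp [ke_ne η h, map_ksmul, H.app_e2 i hi']
  er i l hi := by
    refine LinearMap.ext fun v => ?_
    simp only [LinearMap.smul_apply, Module.End.mul_apply]
    by_cases h : i = p
    · subst h
      simp only [ke_self, kr_apply, map_zero, Prod.smul_mk, smul_smul, q_mul_q hq2]
      simp
    · have hi' := hJ i hi h
      simp only [ke_ne η h, kr_apply, map_neg, map_ksmul, H.app_er i l hi', Prod.smul_mk]
      ext
      · rfl
      · simp only [smul_smul, smul_neg]; congr 2; ring

lemma koszul_step (hq1 : ∀ i, q i i = 1) (hq2 : ∀ i j, q i j = (q j i)⁻¹)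
    (haug : ∀ i, aug (skewVar k q i) = 0)
    (C : Cx aug J b deg d ρ η χ o) (p : Fin n) (hJ : ∀ i, J' i → i ≠ p → J i) :
    Cx aug J' (b.prod b) (kdeg deg) (kd d ρ p) (kr ρ p) (ke η p) (kχ q χ p) (Sum.inl o) where
  rels := koszul_rels hq1 hq2 C.rels p hJ
  rb i e := by
    rcases e with e | e
    · ext <;> simp [kr_apply, C.rb, kχ]
    · ext
      · simp [kr_apply]
      · simp [kr_apply, C.rb, kχ, smul_smul, mul_comm]
  good e := by
    rcases e with e | e
    · exact C.good e
    · refine good_mul q (C.good e) ?_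
      have := good_col q hq2 [p]
      have h2 : col q [p] = q p := by funext i; simp
      rwa [h2] at this
  deg0 e := by
    rcases e with e | e
    · simp [kdeg, C.deg0]
    · simp [kdeg]
  chio := C.chio
  dgr i v hv := by
    rw [mem_kGr] at hv ⊢
    exact ⟨add_mem (C.dgr _ _ hv.1) (C.rgr _ _ _ hv.2), neg_mem (C.dgr _ _ hv.2)⟩
  egr l hl i v hv := by
    rw [mem_kGr] at hv ⊢
    by_cases h : l = p
    · subst h
      rw [ke_self]
      refine ⟨zero_mem _, ?_⟩
      simpa using hv.1
    · rw [ke_ne η h]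
      have h1 := C.egr l (hJ l hl h) _ _ hv.1
      have h2 := C.egr l (hJ l hl h) _ _ hv.2
      refine ⟨h1, neg_mem (Gr_ksmul _ ?_)⟩
      convert h2 using 2; ring
  min v e := by
    rcases e with e | e
    · rw [Module.Basis.prod_repr_inl, kd_apply, map_add, Finsupp.add_apply, map_add, C.min,
        C.r_repr, map_smul, map_mul, haug]
      simp
    · rw [Module.Basis.prod_repr_inr, kd_apply, map_neg, Finsupp.neg_apply, map_neg, C.min, neg_zero]

end Koszul

end CxPart
end SkewCI


namespace SkewCI

section SeriesPart

/-- the generating series of a degree function -/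
def ser {ι : Type} (deg : ι → ℕ) : PowerSeries ℤ :=
  PowerSeries.mk fun i => (Nat.card {e : ι // deg e = i} : ℤ)

lemma kser_fin {ι : Type} (deg : ι → ℕ) (hf : ∀ i, Finite {e : ι // deg e = i}) (i : ℕ) :
    Finite {e : ι ⊕ ι // kdeg deg e = i} := by
  have e := Equiv.subtypeSum (α := ι) (β := ι) (p := fun e => kdeg deg e = i)
  have h1 : Finite {a : ι // kdeg deg (Sum.inl a) = i} := hf i
  have h2 : Finite {a : ι // kdeg deg (Sum.inr a) = i} := by
    cases i with
    | zero => exact Finite.of_injective (β := Empty) (fun x => by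
        have := x.2; simp [kdeg] at this) (fun x => by have := x.2; simp [kdeg] at this)
    | succ i =>
      have := hf i
      exact Finite.of_equiv {e // deg e = i} (Equiv.subtypeEquivRight (by simp [kdeg]))
  exact Finite.of_equiv _ e.symm

lemma kser {ι : Type} (deg : ι → ℕ) (hf : ∀ i, Finite {e : ι // deg e = i}) :
    ser (kdeg deg) = ser deg * (1 + PowerSeries.X) := by
  ext i
  rw [mul_add, mul_one, map_add, ser, ser, PowerSeries.coeff_mk, PowerSeries.coeff_mk]
  have e := Equiv.subtypeSum (α := ι) (β := ι) (p := fun e => kdeg deg e = i)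
  have h1 : Finite {a : ι // kdeg deg (Sum.inl a) = i} := hf i
  cases i with
  | zero =>
    rw [PowerSeries.coeff_zero_mul_X, add_zero]
    congr 1
    have : IsEmpty {a : ι // kdeg deg (Sum.inr a) = 0} := ⟨fun x => by
        have := x.2; simp [kdeg] at this⟩
    rw [Nat.card_congr (e.trans (Equiv.sumEmpty _ _))]
    rfl
  | succ i =>
    rw [PowerSeries.coeff_succ_mul_X, PowerSeries.coeff_mk]
    have e2 : {e // deg e = i} ≃ {a : ι // kdeg deg (Sum.inr a) = i + 1} :=
      Equiv.subtypeEquivRight (by simp [kdeg])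
    have := hf i
    have : Finite {a : ι // kdeg deg (Sum.inr a) = i + 1} := Finite.of_equiv _ e2
    rw [Nat.card_congr e, Nat.card_sum, Nat.card_congr e2]
    push_cast
    rfl

/-- degrees in the divided power step -/
def ddeg {ι : Type} (deg : ι → ℕ) (e : Σ _ : ℕ, ι) : ℕ := deg e.2 + 2 * e.1

/-- splitting off the zeroth power -/
def dsplit {ι : Type} (deg : ι → ℕ) (i : ℕ) : {e : Σ _ : ℕ, ι // ddeg deg e = i} ≃
    {e : ι // deg e = i} ⊕ {e : Σ _ : ℕ, ι // ddeg deg e + 2 = i} where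
  toFun
    | ⟨⟨0, e⟩, h⟩ => Sum.inl ⟨e, by simpa [ddeg] using h⟩
    | ⟨⟨m + 1, e⟩, h⟩ => Sum.inr ⟨⟨m, e⟩, by simp [ddeg] at h ⊢; omega⟩
  invFun
    | Sum.inl ⟨e, h⟩ => ⟨⟨0, e⟩, by simpa [ddeg] using h⟩
    | Sum.inr ⟨⟨m, e⟩, h⟩ => ⟨⟨m + 1, e⟩, by simp [ddeg] at h ⊢; omega⟩
  left_inv := by
    rintro ⟨⟨m, e⟩, h⟩
    cases m <;> rfl
  right_inv := by
    rintro (⟨e, h⟩ | ⟨⟨m, e⟩, h⟩) <;> rfl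

lemma dser_fin {ι : Type} (deg : ι → ℕ) (hf : ∀ i, Finite {e : ι // deg e = i}) (i : ℕ) :
    Finite {e : Σ _ : ℕ, ι // ddeg deg e = i} := by
  induction i using Nat.strong_induction_on with
  | _ i ih =>
    have := hf i
    have : Finite {e : Σ _ : ℕ, ι // ddeg deg e + 2 = i} := by
      by_cases h : 2 ≤ i
      · have := ih (i - 2) (by omega)
        exact Finite.of_equiv {e : Σ _ : ℕ, ι // ddeg deg e = i - 2}
          (Equiv.subtypeEquivRight (by intro x; omega))
      · have : IsEmpty {e : Σ _ : ℕ, ι // ddeg deg e + 2 = i} := ⟨fun x => by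
          have := x.2; omega⟩
        infer_instance
    exact Finite.of_equiv _ (dsplit deg i).symm

lemma dser {ι : Type} (deg : ι → ℕ) (hf : ∀ i, Finite {e : ι // deg e = i}) :
    ser (ddeg deg) * (1 - PowerSeries.X ^ 2) = ser deg := by
  have key : ser (ddeg deg) = ser deg + ser (ddeg deg) * PowerSeries.X ^ 2 := by
    ext i
    rw [map_add, PowerSeries.coeff_mul_X_pow']
    simp only [ser, PowerSeries.coeff_mk]
    have := hf i
    by_cases h : 2 ≤ i
    · have e2 : {e : Σ _ : ℕ, ι // ddeg deg e = i - 2} ≃ {e : Σ _ : ℕ, ι // ddeg deg e + 2 = i} :=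
        (Equiv.subtypeEquivRight (by intro x; omega))
      have := dser_fin deg hf (i - 2)
      have : Finite {e : Σ _ : ℕ, ι // ddeg deg e + 2 = i} := Finite.of_equiv _ e2
      rw [if_pos h, Nat.card_congr (dsplit deg i), Nat.card_sum, Nat.card_congr e2]
      push_cast
      rfl
    · have : IsEmpty {e : Σ _ : ℕ, ι // ddeg deg e + 2 = i} := ⟨fun x => by
          have := x.2; omega⟩
      rw [if_neg h, Nat.card_congr ((dsplit deg i).trans (Equiv.sumEmpty _ _)), add_zero]
  rw [mul_sub, mul_one]
  nth_rewrite 1 [key]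
  ring

end SeriesPart

section KEx

variable {k : Type} [Field k] {n : ℕ} {q : Fin n → Fin n → kˣ}
  {ι F : Type} [AddCommGroup F] [Module (SkewPoly k q) F] [Module k F]
  [IsScalarTower k (SkewPoly k q) F]

/-- exactness at a Koszul stage -/
structure KEx (p : ℕ) (b : Module.Basis ι (SkewPoly k q) F) (d : Module.End (SkewPoly k q) F)
    (o : ι) : Prop where
  d2 : ∀ v, d (d v) = 0
  ex : ∀ v, d v = 0 → ∃ w, ∃ r : SkewPoly k q, v = d w + r • b o
  h0 : ∀ (r : SkewPoly k q) w, d w = r • b o → r ∈ LL q p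

variable {aug : SkewPoly k q →ₐ[k] k} {J : Fin n → Prop}
    {b : Module.Basis ι (SkewPoly k q) F} {deg : ι → ℕ} {d : Module.End (SkewPoly k q) F}
    {ρ η : Fin n → Module.End (SkewPoly k q) F} {χ : ι → Fin n → kˣ} {o : ι}

lemma Cx.r_bo (C : Cx aug J b deg d ρ η χ o) (i : Fin n) : ρ i (b o) = skewVar k q i • b o := by
  rw [C.rb, C.chio]; simp

lemma Cx.LL_bdry (C : Cx aug J b deg d ρ η χ o) (p : ℕ) (hJ : ∀ i : Fin n, i.val < p → J i)
    (r : SkewPoly k q) (hr : r ∈ LL q p) : ∃ w, d w = r • b o := by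
  induction hr using Submodule.span_induction with
  | mem x h =>
    obtain ⟨i, hi, rfl⟩ := h
    refine ⟨η i (b o), ?_⟩
    have := C.rels.app_de i (hJ i hi) (b o)
    rw [C.d_bo, map_zero, add_zero] at this
    rw [this, C.r_bo]
  | zero => exact ⟨0, by simp⟩
  | add x y _ _ hx hy =>
    obtain ⟨w, hw⟩ := hx
    obtain ⟨w', hw'⟩ := hy
    exact ⟨w + w', by rw [map_add, hw, hw', add_smul]⟩
  | smul a x _ hx =>
    obtain ⟨w, hw⟩ := hx
    exact ⟨a • w, by rw [map_smul, hw, smul_smul, smul_eq_mul]⟩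

lemma koszul_ex (hq1 : ∀ i, q i i = 1) (hq2 : ∀ i j, q i j = (q j i)⁻¹) (p : Fin n)
    (C : Cx aug (fun i => i.val < p.val) b deg d ρ η χ o) (E : KEx p.val b d o) :
    KEx (p.val + 1) (b.prod b) (kd d ρ p) (Sum.inl o) where
  d2 v := by
    rw [kd_apply, kd_apply]
    simp [E.d2, C.rels.app_dr]
  ex v hv := by
    obtain ⟨v, w⟩ := v
    rw [kd_apply, Prod.mk_eq_zero] at hv
    obtain ⟨h1, h2⟩ := hv
    simp only [neg_eq_zero] at h1 h2
    obtain ⟨w', r, rfl⟩ := E.ex w h2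
    have h3 : d (-(v + ρ p w')) = (r * skewVar k q p) • b o := by
      rw [map_add, map_smul, C.r_bo, ← C.rels.app_dr, smul_smul] at h1
      rw [map_neg, map_add, neg_eq_iff_add_eq_zero, add_assoc]
      exact h1
    have hr := LL_reg q hq1 hq2 p r (E.h0 _ _ h3)
    obtain ⟨w'', hw''⟩ := C.LL_bdry p.val (fun i hi => hi) r hr
    rw [← hw'', ← map_add] at h1 ⊢
    rw [← C.rels.app_dr, ← map_add] at h1
    obtain ⟨u, r', hu⟩ := E.ex _ h1
    refine ⟨(u, -(w' + w'')), r', ?_⟩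
    rw [kd_apply]
    ext
    · simp only [map_neg, Prod.fst_add, Prod.smul_fst, Module.Basis.prod_apply_inl_fst]
      rw [add_right_comm, ← hu]; abel
    · simp
  h0 r w hw := by
    obtain ⟨v, w⟩ := w
    rw [kd_apply] at hw
    have h1 := congrArg Prod.fst hw
    have h2 := congrArg Prod.snd hw
    simp only [Prod.smul_fst, Prod.smul_snd, Module.Basis.prod_apply_inl_fst,
      Module.Basis.prod_apply_inl_snd, smul_zero, neg_eq_zero] at h1 h2
    obtain ⟨w', r', rfl⟩ := E.ex w h2
    rw [map_add, map_smul, C.r_bo, ← C.rels.app_dr, smul_smul, ← add_assoc, ← map_add,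
      ← eq_sub_iff_add_eq, ← sub_smul] at h1
    have h3 := E.h0 _ _ h1
    have h4 : LL q p.val ≤ LL q (p.val + 1) := Ideal.span_mono (by
      rintro _ ⟨i, hi, rfl⟩; exact ⟨i, by omega, rfl⟩)
    have h5 : r' * skewVar k q p ∈ LL q (p.val + 1) :=
      Ideal.mul_mem_left _ _ (Ideal.subset_span ⟨p, by omega, rfl⟩)
    have := add_mem (h4 h3) h5
    simpa using this

end KEx

section KStage

variable {k : Type} [Field k] {n : ℕ}

/-- existence of a Koszul stage -/
def KStage (q : Fin n → Fin n → kˣ) (aug : SkewPoly k q →ₐ[k] k) (p : ℕ) : Prop :=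
  ∃ (ι F : Type) (_ : AddCommGroup F) (_ : Module (SkewPoly k q) F) (_ : Module k F)
    (_ : IsScalarTower k (SkewPoly k q) F) (b : Module.Basis ι (SkewPoly k q) F) (deg : ι → ℕ)
    (d : Module.End (SkewPoly k q) F)
    (ρ η : Fin n → Module.End (SkewPoly k q) F) (χ : ι → Fin n → kˣ) (o : ι),
    Cx aug (fun i => i.val < p) b deg d ρ η χ o ∧ KEx p b d o ∧
    (∀ i, Finite {e : ι // deg e = i}) ∧ ser deg = (1 + PowerSeries.X) ^ p

lemma KStage_zero (q : Fin n → Fin n → kˣ) (aug : SkewPoly k q →ₐ[k] k) : KStage q aug 0 := by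
  refine ⟨Unit, SkewPoly k q, inferInstance, inferInstance, inferInstance, inferInstance,
    Module.Basis.singleton Unit _, fun _ => 0, 0,
    fun i => LinearMap.toSpanSingleton _ _ (skewVar k q i), 0, fun _ => 1, (), ?_, ?_, ?_, ?_⟩
  · refine ⟨⟨?_, by simp, by simp, by simp, by simp, by simp⟩, ?_, fun _ => good_one q, by simp,
      rfl, by simp, by simp, by simp⟩
    · intro i l
      refine LinearMap.ext fun a => ?_
      simp only [Module.End.mul_apply, LinearMap.smul_apply, LinearMap.toSpanSingleton_apply,
        smul_eq_mul]
      rw [mul_assoc, rel, mul_smul_comm, mul_assoc]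
    · intro i e
      simp
  · refine ⟨by simp, fun v _ => ⟨0, v, by simp⟩, fun r w h => ?_⟩
    simp at h
    rw [← h]; exact zero_mem _
  · intro i; infer_instance
  · ext i
    rw [ser, PowerSeries.coeff_mk, pow_zero, PowerSeries.coeff_one]
    split_ifs with h
    · subst h; simp
    · have : IsEmpty {e : Unit // 0 = i} := ⟨fun x => h x.2.symm⟩
      simp

lemma KStage_all (q : Fin n → Fin n → kˣ) (aug : SkewPoly k q →ₐ[k] k) 
    (hq1 : ∀ i, q i i = 1) (hq2 : ∀ i j, q i j = (q j i)⁻¹)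
    (haug : ∀ i, aug (skewVar k q i) = 0) (p : ℕ) (hp : p ≤ n) : KStage q aug p := by
  induction p with
  | zero => exact KStage_zero q aug
  | succ p ih =>
    obtain ⟨ι, F, _, _, _, _, b, deg, d, ρ, η, χ, o, C, E, hf, hs⟩ := ih (by omega)
    refine ⟨ι ⊕ ι, F × F, inferInstance, inferInstance, inferInstance, inferInstance, b.prod b,
      kdeg deg, kd d ρ ⟨p, hp⟩, kr ρ ⟨p, hp⟩, ke η ⟨p, hp⟩, kχ q χ ⟨p, hp⟩, Sum.inl o,
      koszul_step hq1 hq2 haug C ⟨p, hp⟩ ?_, koszul_ex hq1 hq2 ⟨p, hp⟩ C E, kser_fin deg hf, ?_⟩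
    · intro i hi hne
      have : i.val ≠ p := fun h => hne (Fin.ext h)
      omega
    · rw [kser deg hf, hs, pow_succ]

end KStage
end SkewCI


namespace SkewCI

section DivPart

set_option linter.unusedSectionVars false

variable {k : Type} [Field k] {n : ℕ} {q : Fin n → Fin n → kˣ}
  {ι F : Type} [AddCommGroup F] [Module (SkewPoly k q) F] [Module k F]
  [IsScalarTower k (SkewPoly k q) F]

variable {aug : SkewPoly k q →ₐ[k] k} {J : Fin n → Prop}
    {b : Module.Basis ι (SkewPoly k q) F} {deg : ι → ℕ} {d : Module.End (SkewPoly k q) F}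
    {ρ η : Fin n → Module.End (SkewPoly k q) F} {χ : ι → Fin n → kˣ} {o : ι}

lemma Cx.rword_b (C : Cx aug J b deg d ρ η χ o) (w : List (Fin n)) (e : ι) :
    rword ρ w (b e) = (((w.map (χ e)).prod : kˣ) : k) • (wp q w • b e) := by
  induction w with
  | nil => simp [rword]
  | cons l w ih =>
    rw [rword, Module.End.mul_apply, C.rb, map_ksmul, map_smul, ih, wp_cons,
      smul_comm (skewVar k q l), smul_smul, smul_smul]
    simp

lemma Cx.exists_s (C : Cx aug (fun _ => True) b deg d ρ η χ o) {D : ℕ} (hD : 2 ≤ D)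
    {w0 : List (Fin n)} {f : SkewPoly k q} (hf : f ∈ CW q D w0) :
    ∃ s ∈ ZZ q ρ η D w0,
      (∀ e, (d * s + s * d) (b e) = (((w0.map (χ e)).prod : kˣ) : k) • (f • b e)) ∧
      d * (d * s + s * d) = (d * s + s * d) * d := by
  induction hf using Submodule.span_induction with
  | mem x h =>
    obtain ⟨w, h1, h2, rfl⟩ := h
    refine ⟨zw ρ η w, Submodule.subset_span ⟨w, h1, h2, rfl⟩, ?_⟩
    cases w with
    | nil => simp at h1; omega
    | cons l w =>
      rw [C.rels.z_d]
      refine ⟨fun e => ?_, C.rels.rw_d _⟩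
      rw [C.rword_b, C.good e _ _ h2]
  | zero => exact ⟨0, zero_mem _, by simp, by simp⟩
  | add x y _ _ hx hy =>
    obtain ⟨s, h1, h2, h3⟩ := hx
    obtain ⟨t, h4, h5, h6⟩ := hy
    have e : d * (s + t) + (s + t) * d = (d * s + s * d) + (d * t + t * d) := by
      rw [mul_add, add_mul]; abel
    refine ⟨s + t, add_mem h1 h4, fun e' => ?_, ?_⟩
    · rw [e, LinearMap.add_apply, h2, h5, add_smul, smul_add]
    · rw [e, mul_add, add_mul, h3, h6]
  | smul c x _ hx =>
    obtain ⟨s, h1, h2, h3⟩ := hx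
    have e : d * (c • s) + (c • s) * d = c • (d * s + s * d) := by
      rw [mul_smul_comm, smul_mul_assoc, smul_add]
    refine ⟨c • s, Submodule.smul_mem _ _ h1, fun e' => ?_, ?_⟩
    · rw [e, LinearMap.smul_apply, h2, smul_assoc, smul_comm]
    · rw [e, mul_smul_comm, smul_mul_assoc, h3]

lemma Cx.rword_gr (C : Cx aug J b deg d ρ η χ o) (w : List (Fin n)) (i : ℤ) (v : F)
    (hv : v ∈ Gr b deg i) : rword ρ w v ∈ Gr b deg i := by
  induction w generalizing v with
  | nil => exact hv
  | cons l w ih => exact ih _ (C.rgr _ _ _ hv)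

lemma Cx.s_gr (C : Cx aug (fun _ => True) b deg d ρ η χ o) {D : ℕ}
    {w0 : List (Fin n)} {s : Module.End (SkewPoly k q) F} (hs : s ∈ ZZ q ρ η D w0) (i : ℤ) (v : F)
    (hv : v ∈ Gr b deg i) : s v ∈ Gr b deg (i + 1) := by
  induction hs using Submodule.span_induction with
  | mem x h =>
    obtain ⟨w, h1, h2, rfl⟩ := h
    cases w with
    | nil => exact zero_mem _
    | cons l w => exact C.rword_gr _ _ _ (C.egr l trivial _ _ hv)
  | zero => exact zero_mem _
  | add x y _ _ hx hy => exact add_mem hx hy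
  | smul c x _ hx => exact Gr_ksmul _ hx

lemma Cx.s_min (C : Cx aug (fun _ => True) b deg d ρ η χ o)
    (haug : ∀ i, aug (skewVar k q i) = 0) {D : ℕ} (hD : 2 ≤ D)
    {w0 : List (Fin n)} {s : Module.End (SkewPoly k q) F} (hs : s ∈ ZZ q ρ η D w0) (v : F) :
    s v ∈ IF b (RingHom.ker (aug : SkewPoly k q →+* k)) := by
  induction hs using Submodule.span_induction with
  | mem x h =>
    obtain ⟨w, h1, h2, rfl⟩ := h
    rcases w with _ | ⟨l, _ | ⟨l', w⟩⟩
    · exact zero_mem _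
    · simp at h1; omega
    · have h3 : ρ l' (η l v) ∈ IF b (RingHom.ker (aug : SkewPoly k q →+* k)) := by
        intro e
        rw [C.r_repr, RingHom.mem_ker]
        change aug _ = 0
        rw [map_smul, map_mul, haug]; simp
      exact IF_stable b _ (rword ρ w) h3
  | zero => exact zero_mem _
  | add x y _ _ hx hy => exact add_mem hx hy
  | smul c x _ hx => exact IF_ksmul _ hx

/-- power-wise operator -/
def dS (T : ℕ → Module.End (SkewPoly k q) F) : Module.End (SkewPoly k q) (ℕ →₀ F) where
  toFun v := Finsupp.onFinset v.support (fun m => T m (v m)) (by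
    intro m hm
    rw [Finsupp.mem_support_iff]
    intro h
    simp [h] at hm)
  map_add' v w := by ext m; simp
  map_smul' a v := by ext m; simp

@[simp] lemma dS_apply (T : ℕ → Module.End (SkewPoly k q) F) (v : ℕ →₀ F) (m : ℕ) :
    dS T v m = T m (v m) := rfl

/-- new differential -/
def dd (d s : Module.End (SkewPoly k q) F) : Module.End (SkewPoly k q) (ℕ →₀ F) :=
  dS (fun _ => d) + dS (fun _ => s) * Finsupp.lcomapDomain Nat.succ Nat.succ_injective

lemma dd_apply (d s : Module.End (SkewPoly k q) F) (v : ℕ →₀ F) (m : ℕ) :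
    dd d s v m = d (v m) + s (v (m + 1)) := rfl

/-- twisted extension -/
def dt (w0 : List (Fin n)) (ρ : Fin n → Module.End (SkewPoly k q) F) (i : Fin n) :
    Module.End (SkewPoly k q) (ℕ →₀ F) :=
  dS (fun m => (col q w0 i : k) ^ m • ρ i)

lemma dt_apply (w0 : List (Fin n)) (ρ : Fin n → Module.End (SkewPoly k q) F) (i : Fin n)
    (v : ℕ →₀ F) (m : ℕ) : dt w0 ρ i v m = (col q w0 i : k) ^ m • ρ i (v m) := rfl

lemma mem_dGr {i : ℤ} {v : ℕ →₀ F} :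
    v ∈ Gr (Finsupp.basis fun _ : ℕ => b) (ddeg deg) i ↔ ∀ m : ℕ, v m ∈ Gr b deg (i - 2 * m) := by
  simp only [mem_Gr, Sigma.forall, ddeg, Finsupp.basis_repr, Nat.cast_add, Nat.cast_mul,
    Nat.cast_ofNat, eq_sub_iff_add_eq]

lemma mem_dIF {I : Ideal (SkewPoly k q)} {v : ℕ →₀ F} :
    v ∈ IF (Finsupp.basis fun _ : ℕ => b) I ↔ ∀ m : ℕ, v m ∈ IF b I := by
  simp only [mem_IF, Sigma.forall, Finsupp.basis_repr]

lemma div_rels (H : Rels q ρ η J d) {w0 : List (Fin n)} {s : Module.End (SkewPoly k q) F}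
    (h1 : ∀ i, ρ i * s = (col q w0 i : k) • (s * ρ i))
    (h2 : ∀ i, η i * s = -((col q w0 i : k) • (s * η i))) :
    Rels q (dt w0 ρ) (dt w0 η) J (dd d s) where
  rr i l := by
    refine LinearMap.ext fun v => Finsupp.ext fun m => ?_
    simp only [Module.End.mul_apply, LinearMap.smul_apply, Finsupp.smul_apply, dt_apply, map_ksmul,
      H.app_rr i l, smul_smul]
    congr 1; ring
  dr i := by
    refine LinearMap.ext fun v => Finsupp.ext fun m => ?_
    have h3 : ∀ v, ρ i (s v) = (col q w0 i : k) • s (ρ i v) := fun v => LinearMap.congr_fun (h1 i) v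
    simp only [Module.End.mul_apply, dt_apply, dd_apply, map_ksmul, H.app_dr, map_add, h3, smul_add,
      smul_smul, pow_succ]
  de i hi := by
    refine LinearMap.ext fun v => Finsupp.ext fun m => ?_
    have h3 : ∀ v, η i (s v) = -((col q w0 i : k) • s (η i v)) :=
      fun v => LinearMap.congr_fun (h2 i) v
    simp only [LinearMap.add_apply, Finsupp.add_apply, Module.End.mul_apply, dt_apply, dd_apply,
      map_ksmul, map_add, h3, smul_add, smul_smul, ← H.app_de i hi, smul_neg, pow_succ]
    abel
  ee i l hi hl := by
    refine LinearMap.ext fun v => Finsupp.ext fun m => ?_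
    simp only [LinearMap.neg_apply, Finsupp.neg_apply, Module.End.mul_apply, LinearMap.smul_apply,
      Finsupp.smul_apply, dt_apply, map_ksmul, H.app_ee i l hi hl, smul_smul, smul_neg]
    congr 2; ring
  e2 i hi := by
    refine LinearMap.ext fun v => Finsupp.ext fun m => ?_
    simp [Module.End.mul_apply, dt_apply, map_ksmul, H.app_e2 i hi]
  er i l hi := by
    refine LinearMap.ext fun v => Finsupp.ext fun m => ?_
    simp only [Module.End.mul_apply, LinearMap.smul_apply, Finsupp.smul_apply, dt_apply, map_ksmul,
      H.app_er i l hi, smul_smul]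
    congr 1; ring

/-- new weights -/
def dχ (q : Fin n → Fin n → kˣ) (w0 : List (Fin n)) (χ : ι → Fin n → kˣ) (e : Σ _ : ℕ, ι) :
    Fin n → kˣ := χ e.2 * col q w0 ^ e.1

lemma div_step (hq2 : ∀ i j, q i j = (q j i)⁻¹)
    (haug : ∀ i, aug (skewVar k q i) = 0)
    (C : Cx aug (fun _ => True) b deg d ρ η χ o) {D : ℕ} (hD : 2 ≤ D)
    {w0 : List (Fin n)} {s : Module.End (SkewPoly k q) F} (hs : s ∈ ZZ q ρ η D w0) :
    Cx aug (fun _ => True) (Finsupp.basis fun _ : ℕ => b) (ddeg deg) (dd d s) (dt w0 ρ) (dt w0 η)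
      (dχ q w0 χ) ⟨0, o⟩ where
  rels := div_rels C.rels (C.rels.ZZ_r hq2 hs) (C.rels.ZZ_e hs)
  rb i e := by
    classical
    obtain ⟨m, e⟩ := e
    refine Finsupp.ext fun m' => ?_
    simp only [dt_apply, Finsupp.coe_basis, Finsupp.smul_apply, Finsupp.single_apply]
    split_ifs with h
    · subst h
      rw [C.rb, smul_smul]; simp [dχ, mul_comm]
    · simp
  good e := good_mul q (C.good _) (good_pow q (good_col q hq2 w0) _)
  deg0 e := by
    obtain ⟨m, e⟩ := e
    have := C.deg0 e
    constructor
    · intro h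
      simp only [ddeg] at h
      have h1 : m = 0 := by omega
      have h2 : deg e = 0 := by omega
      rw [h1, this.1 h2]
    · intro h
      cases h
      simpa [ddeg] using this
  chio := by simp [dχ, C.chio]
  dgr i v hv := by
    rw [mem_dGr] at hv ⊢
    intro m
    rw [dd_apply]
    refine add_mem ?_ ?_
    · convert C.dgr _ _ (hv m) using 2; ring
    · convert C.s_gr hs _ _ (hv (m + 1)) using 2; push_cast; ring
  egr l hl i v hv := by
    rw [mem_dGr] at hv ⊢
    intro m
    rw [dt_apply]
    apply Gr_ksmul
    convert C.egr l hl _ _ (hv m) using 2; ring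
  min v e := by
    rw [Finsupp.basis_repr, dd_apply, map_add, Finsupp.add_apply, map_add, C.min, zero_add]
    exact C.s_min haug hD hs _ _

/-- exactness modulo an ideal -/
structure IEx (I : Ideal (SkewPoly k q)) (b : Module.Basis ι (SkewPoly k q) F)
    (d : Module.End (SkewPoly k q) F) (o : ι) : Prop where
  d2 : ∀ v, d (d v) ∈ IF b I
  ex : ∀ v, d v ∈ IF b I → ∃ w, ∃ c : k, v - d w - c • b o ∈ IF b I

lemma IF_mono {I I' : Ideal (SkewPoly k q)} (h : I ≤ I') {v : F} (hv : v ∈ IF b I) :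
    v ∈ IF b I' := fun e => h (hv e)

lemma div_ex (C : Cx aug (fun _ => True) b deg d ρ η χ o) {I I' : Ideal (SkewPoly k q)}
    [I.IsTwoSided] [I'.IsTwoSided]
    {f : SkewPoly k q} (hI : I ≤ I') (hf : f ∈ I') (hI' : ∀ a ∈ I', ∃ r, a - r * f ∈ I)
    (hm : ∀ a ∈ I, aug a = 0)
    (hreg : ∀ a, a * f ∈ I → a ∈ I) (E : IEx I b d o)
    {s : Module.End (SkewPoly k q) F} {β : ι → kˣ} (hss : s * s = 0)
    (hsb : ∀ e, (d * s + s * d) (b e) = (β e : k) • (f • b e))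
    (hsd : d * (d * s + s * d) = (d * s + s * d) * d) :
    IEx I' (Finsupp.basis fun _ : ℕ => b) (dd d s) ⟨0, o⟩ := by
  classical
  set φ := d * s + s * d with hφ
  have φr : ∀ v e, b.repr (φ v) e = (β e : k) • (b.repr v e * f) :=
    fun v e => Cx.diag (β := fun e => (β e : k)) hsb v e
  have φ1 : ∀ v, φ v ∈ IF b I' := by
    intro v e
    rw [φr, Algebra.smul_def]
    exact Ideal.mul_mem_left _ _ (Ideal.mul_mem_left _ _ hf)
  have φ2 : ∀ v, φ v ∈ IF b I → v ∈ IF b I := by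
    intro v hv e
    apply hreg
    have h1 := hv e
    rw [φr] at h1
    have h2 := I.mul_mem_left (algebraMap k _ ((β e)⁻¹ : kˣ).val) h1
    rw [← Algebra.smul_def, smul_smul, ← Units.val_mul] at h2
    simpa using h2
  have φ3 : ∀ v, v ∈ IF b I' → ∃ u, v - φ u ∈ IF b I := by
    intro v hv
    choose r hr using fun e => hI' _ (hv e)
    refine ⟨b.repr.symm (Finsupp.onFinset (b.repr v).support
      (fun e => if b.repr v e = 0 then 0 else (((β e)⁻¹ : kˣ) : k) • r e) ?_), ?_⟩
    · intro e he
      rw [Finsupp.mem_support_iff]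
      intro h
      simp [h] at he
    · intro e
      rw [map_sub, Finsupp.sub_apply, φr, LinearEquiv.apply_symm_apply, Finsupp.onFinset_apply]
      split_ifs with h
      · simp [h]
      · rw [smul_mul_assoc, smul_smul, ← Units.val_mul]
        simpa using hr e
  have φd : ∀ v, d (φ v) = φ (d v) := fun v => LinearMap.congr_fun hsd v
  have φa : ∀ v, φ v = d (s v) + s (d v) := fun v => rfl
  have sS : ∀ v, s (s v) = 0 := fun v => LinearMap.congr_fun hss v
  have φo : φ (b o) = d (s (b o)) := by rw [φa, C.d_bo, map_zero, add_zero]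
  have dS' : ∀ v, d (d v) ∈ IF b I := E.d2
  have hd2 : ∀ v, dd d s (dd d s v) ∈ IF (Finsupp.basis fun _ : ℕ => b) I' := by
    intro v
    rw [mem_dIF]
    intro m
    have : dd d s (dd d s v) m = d (d (v m)) + φ (v (m + 1)) := by
      rw [dd_apply, dd_apply, dd_apply, map_add d, map_add s, sS, φa]; abel
    rw [this]
    exact add_mem (IF_mono hI (E.d2 _)) (φ1 _)
  refine ⟨hd2, ?_⟩
  have main : ∀ M : ℕ, ∀ v : ℕ →₀ F, dd d s v ∈ IF (Finsupp.basis fun _ : ℕ => b) I' →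
      (∀ m, M ≤ m → v m ∈ IF b I') → ∃ w, ∃ c : k, v - dd d s w -
        c • (Finsupp.basis fun _ : ℕ => b) ⟨0, o⟩ ∈ IF (Finsupp.basis fun _ : ℕ => b) I' := by
    intro M
    induction M with
    | zero =>
      intro v _ hv
      refine ⟨0, 0, ?_⟩
      rw [map_zero, zero_smul, sub_zero, sub_zero, mem_dIF]
      exact fun m => hv m (Nat.zero_le m)
    | succ M ih =>
      intro v hv hM
      have hv' := mem_dIF.1 hv
      have h1 : d (v M) ∈ IF b I' := by
        have := sub_mem (hv' M) (IF_stable b I' s (hM (M + 1) le_rfl))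
        rwa [dd_apply, add_sub_cancel_right] at this
      obtain ⟨w, hw⟩ := φ3 _ h1
      have h2 : d w ∈ IF b I := by
        apply φ2
        rw [← φd]
        have := sub_mem (E.d2 (v M)) (IF_stable b I d hw)
        rwa [map_sub, sub_sub_cancel] at this
      obtain ⟨u, c, hu⟩ := E.ex _ h2
      have h3 : d (v M - φ u - c • s (b o)) ∈ IF b I := by
        have := add_mem hw (IF_stable b I φ hu)
        rw [map_sub, map_sub, map_ksmul, φo] at this
        rw [map_sub, map_sub, map_ksmul, φd]
        convert this using 1; abel
      obtain ⟨u', c', hu'⟩ := E.ex _ h3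
      let t : ℕ →₀ F := Finsupp.single (M + 1) (c • b o) + Finsupp.single M u'
      let v' := v - dd d s t
      have hv'c : dd d s v' ∈ IF (Finsupp.basis fun _ : ℕ => b) I' := by
        rw [map_sub]
        exact sub_mem hv (hd2 _)
      have tM : t M = u' := by simp [t]
      have tM1 : t (M + 1) = c • b o := by simp [t]
      have tgt : ∀ m, M + 1 < m → t m = 0 := by
        intro m hm
        have h1 : M + 1 ≠ m := by omega
        have h2 : M ≠ m := by omega
        simp [t, Finsupp.single_apply, h1, h2]
      have v'gt : ∀ m, M < m → v' m ∈ IF b I' := by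
        intro m hm
        have : dd d s t m = 0 := by
          rw [dd_apply, tgt (m + 1) (by omega), map_zero, add_zero]
          rcases Nat.lt_or_ge (M + 1) m with h | h
          · rw [tgt m h, map_zero]
          · have : m = M + 1 := by omega
            rw [this, tM1, map_ksmul, C.d_bo, smul_zero]
        change v m - dd d s t m ∈ _
        rw [this, sub_zero]
        exact hM m hm
      have v'M : v' M - c' • b o ∈ IF b I' := by
        change v M - dd d s t M - c' • b o ∈ _
        rw [dd_apply, tM, tM1, map_ksmul]
        have := add_mem (IF_mono hI hu') (φ1 u)
        convert this using 1; abel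
      cases M with
      | zero =>
        refine ⟨t, c', ?_⟩
        rw [mem_dIF]
        intro m
        change v' m - (c' • (Finsupp.basis fun _ : ℕ => b) ⟨0, o⟩ : ℕ →₀ F) m ∈ _
        rw [Finsupp.smul_apply, Finsupp.coe_basis]
        cases m with
        | zero => simpa using v'M
        | succ m => simpa using v'gt (m + 1) (by omega)
      | succ M =>
        have h4 : d (v' M) + c' • s (b o) ∈ IF b I' := by
          have := sub_mem (mem_dIF.1 hv'c M) (IF_stable b I' s v'M)
          rw [dd_apply, map_sub, map_ksmul] at this
          convert this using 1; abel
        obtain ⟨y, hy⟩ := φ3 _ h4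
        have h5 : c' • b o - d y ∈ IF b I := by
          apply φ2
          have := sub_mem (IF_stable b I d hy) (E.d2 (v' M))
          rw [map_sub, map_add, map_ksmul, ← φo, φd] at this
          rw [map_sub, map_ksmul]
          convert this using 1; abel
        have h6 : c' = 0 := by
          have := hm _ (h5 o)
          rw [map_sub, Finsupp.sub_apply, map_sub, C.min, sub_zero, repr_ksmul, b.repr_self,
            Finsupp.single_eq_same, map_smul, map_one] at this
          simpa using this
        rw [h6, zero_smul, sub_zero] at v'M
        obtain ⟨w', c'', hw'⟩ := ih v' hv'c (by
          intro m hm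
          rcases Nat.lt_or_ge (M + 1) m with h | h
          · exact v'gt m h
          · have : m = M + 1 := by omega
            rw [this]; exact v'M)
        refine ⟨t + w', c'', ?_⟩
        rw [map_add, ← sub_sub]
        exact hw'
  intro v hv
  refine main (v.support.sup id + 1) v hv fun m hm => ?_
  have : v m = 0 := by
    by_contra h
    have h1 : m ∈ v.support := by simpa using h
    have := Finset.le_sup (f := id) h1
    simp only [id] at this
    omega
  rw [this]; exact zero_mem _

end DivPart
end SkewCI


namespace SkewCI

section RedPart

set_option linter.unusedSectionVars false

variable {k : Type} [Field k] {n : ℕ} {q : Fin n → Fin n → kˣ}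
  {ι F : Type} [AddCommGroup F] [Module (SkewPoly k q) F] [Module k F]
  [IsScalarTower k (SkewPoly k q) F]
  {R : Type} [Ring R] [Algebra k R] (π : SkewPoly k q →ₐ[k] R)

/-- reduction of coordinates -/
def red (b : Module.Basis ι (SkewPoly k q) F) : F →+ (ι →₀ R) :=
  (Finsupp.mapRange.addMonoidHom (π : SkewPoly k q →+ R)).comp
    (b.repr : F ≃+ (ι →₀ SkewPoly k q)).toAddMonoidHom

lemma red_apply (b : Module.Basis ι (SkewPoly k q) F) (v : F) (e : ι) :
    red π b v e = π (b.repr v e) := rfl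

lemma red_smul (b : Module.Basis ι (SkewPoly k q) F) (a : SkewPoly k q) (v : F) :
    red π b (a • v) = π a • red π b v := by
  ext e
  simp [red_apply]

lemma red_surj (hπ : Function.Surjective π) (b : Module.Basis ι (SkewPoly k q) F) (u : ι →₀ R) :
    ∃ v, red π b v = u := by
  induction u using Finsupp.induction_linear with
  | zero => exact ⟨0, map_zero _⟩
  | add u u' h h' =>
    obtain ⟨v, rfl⟩ := h
    obtain ⟨v', rfl⟩ := h'
    exact ⟨v + v', map_add _ _ _⟩
  | single e r =>
    classical
    obtain ⟨a, rfl⟩ := hπ r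
    refine ⟨a • b e, ?_⟩
    ext e'
    rw [red_apply, map_smul, b.repr_self, Finsupp.smul_apply, Finsupp.single_apply,
      Finsupp.single_apply]
    split_ifs <;> simp

lemma red_eq_zero (b : Module.Basis ι (SkewPoly k q) F) (v : F) :
    red π b v = 0 ↔ v ∈ IF b (RingHom.ker (π : SkewPoly k q →+* R)) := by
  rw [Finsupp.ext_iff, mem_IF]
  rfl

/-- reduced differential -/
def dR (b : Module.Basis ι (SkewPoly k q) F) (d : Module.End (SkewPoly k q) F) :
    (ι →₀ R) →ₗ[R] (ι →₀ R) :=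
  Finsupp.linearCombination R (fun e => red π b (d (b e)))

lemma dR_red (b : Module.Basis ι (SkewPoly k q) F) (d : Module.End (SkewPoly k q) F) (v : F) :
    dR π b d (red π b v) = red π b (d v) := by
  classical
  have h1 : red π b v = (b.repr v).sum fun e a => Finsupp.single e (π a) := by
    ext e
    rw [red_apply, Finsupp.sum_apply, Finsupp.sum]
    simp only [Finsupp.single_apply]
    rw [Finset.sum_ite_eq']
    split_ifs with h
    · rfl
    · simp at h; simp [h]
  rw [h1]
  conv_rhs => rw [← b.linearCombination_repr v, Finsupp.linearCombination_apply]
  rw [Finsupp.sum, Finsupp.sum, map_sum, map_sum, map_sum]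
  refine Finset.sum_congr rfl fun e _ => ?_
  rw [map_smul, red_smul, dR, Finsupp.linearCombination_single]

variable {aug : SkewPoly k q →ₐ[k] k} {J : Fin n → Prop}
    {b : Module.Basis ι (SkewPoly k q) F} {deg : ι → ℕ} {d : Module.End (SkewPoly k q) F}
    {ρ η : Fin n → Module.End (SkewPoly k q) F} {χ : ι → Fin n → kˣ} {o : ι}

/-- inclusion of a degree -/
def inc (deg : ι → ℕ) (i : ℕ) : ({e : ι // deg e = i} →₀ R) →ₗ[R] (ι →₀ R) :=
  Finsupp.lmapDomain R R Subtype.val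

/-- restriction to a degree -/
def res (deg : ι → ℕ) (i : ℕ) : (ι →₀ R) →ₗ[R] ({e : ι // deg e = i} →₀ R) :=
  Finsupp.lsubtypeDomain {e | deg e = i}

lemma res_apply (deg : ι → ℕ) (i : ℕ) (u : ι →₀ R) (e) : res deg i u e = u e.1 := rfl

lemma inc_apply (deg : ι → ℕ) (i : ℕ) (v : {e : ι // deg e = i} →₀ R) (e) :
    inc deg i v e.1 = v e := Finsupp.mapDomain_apply Subtype.val_injective v e

lemma inc_ne (deg : ι → ℕ) (i : ℕ) (v : {e : ι // deg e = i} →₀ R) (e : ι) (he : deg e ≠ i) :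
    inc deg i v e = 0 := by
  apply Finsupp.mapDomain_of_notMem_range
  rintro ⟨x, rfl⟩
  exact he x.2

lemma res_inc (deg : ι → ℕ) (i : ℕ) (v : {e : ι // deg e = i} →₀ R) : res deg i (inc deg i v) = v := by
  ext e
  rw [res_apply, inc_apply]

lemma dR_gr (C : Cx aug J b deg d ρ η χ o) (u : ι →₀ R) (i : ℕ)
    (hu : ∀ e, u e ≠ 0 → deg e = i) (e' : ι) (he' : dR π b d u e' ≠ 0) : deg e' + 1 = i := by
  classical
  rw [dR, Finsupp.linearCombination_apply, Finsupp.sum, Finsupp.finsetSum_apply] at he'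
  obtain ⟨e, he, h⟩ := Finset.exists_ne_zero_of_sum_ne_zero he'
  have h1 := hu e (by simpa using he)
  have hg : b e ∈ Gr b deg i := by
    intro e'' h2
    rw [b.repr_self, Finsupp.single_apply] at h2
    have : e = e'' := by by_contra h; simp [h] at h2
    rw [← this, h1]
  have := C.dgr _ _ hg e' (by
    intro h3
    apply h
    rw [Finsupp.smul_apply, red_apply, h3]; simp)
  omega

lemma inc_res (u : ι →₀ R) (i : ℕ) (hu : ∀ e, u e ≠ 0 → deg e = i) :
    inc deg i (res deg i u) = u := by
  ext e
  by_cases h : deg e = i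
  · exact inc_apply deg i _ ⟨e, h⟩
  · rw [inc_ne _ _ _ _ h]
    by_contra h'
    exact h (hu e (Ne.symm h'))

/-- the differentials -/
def DD (b : Module.Basis ι (SkewPoly k q) F) (deg : ι → ℕ) (d : Module.End (SkewPoly k q) F)
    (i : ℕ) : ({e : ι // deg e = i + 1} →₀ R) →ₗ[R] ({e : ι // deg e = i} →₀ R) :=
  res deg i ∘ₗ dR π b d ∘ₗ inc deg (i + 1)

lemma DD_apply (i : ℕ) (v : {e : ι // deg e = i + 1} →₀ R) :
    DD π b deg d i v = res deg i (dR π b d (inc deg (i + 1) v)) := rfl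

lemma inc_supp (i : ℕ) (v : {e : ι // deg e = i} →₀ R) (e : ι) (he : inc deg i v e ≠ 0) :
    deg e = i := by
  by_contra h
  exact he (inc_ne _ _ _ _ h)

lemma inc_DD (C : Cx aug J b deg d ρ η χ o) (i : ℕ) (v : {e : ι // deg e = i + 1} →₀ R) :
    inc deg i (DD π b deg d i v) = dR π b d (inc deg (i + 1) v) := by
  rw [DD_apply, inc_res]
  intro e he
  have := dR_gr π C _ (i + 1) (inc_supp (i + 1) v) e he
  omega

lemma res_dR (C : Cx aug J b deg d ρ η χ o) (i : ℕ) (u : ι →₀ R) :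
    res deg i (dR π b d u) = DD π b deg d i (res deg (i + 1) u) := by
  rw [DD_apply]
  have h : res deg i (dR π b d (u - inc deg (i + 1) (res deg (i + 1) u))) = 0 := by
    induction u using Finsupp.induction_linear with
    | zero => simp
    | add u u' h h' =>
      have := congrArg₂ (· + ·) h h'
      simp only [map_add, map_sub, add_zero] at this ⊢
      rw [← this]; abel
    | single e r =>
      classical
      by_cases h : deg e = i + 1
      · rw [inc_res, sub_self, map_zero, map_zero]
        intro e' he'
        rw [Finsupp.single_apply] at he'
        have : e = e' := by by_contra h; simp [h] at he'
        rw [← this, h]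
      · have h0 : res deg (i + 1) (Finsupp.single e r) = 0 := by
          ext ⟨e', he'⟩
          rw [res_apply, Finsupp.single_apply, if_neg]
          · rfl
          · rintro rfl; exact h he'
        rw [h0, map_zero, sub_zero]
        ext ⟨e', he'⟩
        rw [res_apply]
        by_contra h2
        have := dR_gr π C (Finsupp.single e r) (deg e) (by
          intro e'' h3
          rw [Finsupp.single_apply] at h3
          have : e = e'' := by by_contra h; simp [h] at h3
          rw [this]) e' h2
        omega
  rw [map_sub, map_sub, sub_eq_zero] at h
  exact h

theorem ext_card (hπ : Function.Surjective π) (ε : R →ₐ[k] k)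
    (C : Cx (ε.comp π) J b deg d ρ η χ o)
    (E : IEx (RingHom.ker (π : SkewPoly k q →+* R)) b d o)
    (hf : ∀ i, Finite {e : ι // deg e = i}) (i : ℕ) :
    Module.finrank k
          (((Ext k (ModuleCat R) i).obj
              (Opposite.op (ModuleCat.of R (R ⧸ RingHom.ker (ε : R →+* k))))).obj
            (ModuleCat.of R (R ⧸ RingHom.ker (ε : R →+* k)))) = Nat.card {e : ι // deg e = i} := by
  classical
  let U : Unique {e : ι // deg e = 0} :=
    ⟨⟨⟨o, (C.deg0 o).2 rfl⟩⟩, fun x => Subtype.ext ((C.deg0 x.1).1 x.2)⟩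
  have hmin : ∀ i v e, ε (DD π b deg d i v e) = 0 := by
    intro i v e
    rw [DD_apply, res_apply]
    obtain ⟨V, hV⟩ := red_surj π hπ b (inc deg (i + 1) v)
    rw [← hV, dR_red, red_apply]
    exact C.min V e.1
  have hcyc : ∀ u : ι →₀ R, dR π b d u = 0 → ∃ w, ∃ c : k,
      u = dR π b d w + Finsupp.single o (algebraMap k R c) := by
    intro u hu
    obtain ⟨V, rfl⟩ := red_surj π hπ b u
    rw [dR_red, red_eq_zero] at hu
    obtain ⟨w, c, h⟩ := E.ex V hu
    refine ⟨red π b w, c, ?_⟩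
    rw [← red_eq_zero, map_sub, map_sub, sub_sub, sub_eq_zero] at h
    rw [h, dR_red]
    congr 1
    ext e
    rw [red_apply, repr_ksmul, b.repr_self, Finsupp.single_apply, Finsupp.single_apply, map_smul,
      Algebra.algebraMap_eq_smul_one]
    split_ifs <;> simp
  refine finrank_ext ε (fun i => {e : ι // deg e = i}) (DD π b deg d) ?_ hmin hf ?_ ?_ i
  · intro i v
    rw [DD_apply, inc_DD π C]
    obtain ⟨V, hV⟩ := red_surj π hπ b (inc deg (i + 1 + 1) v)
    rw [← hV, dR_red, dR_red, (red_eq_zero π b _).2 (E.d2 V), map_zero]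
  · intro i v hv
    have h1 : dR π b d (inc deg (i + 1) v) = 0 := by rw [← inc_DD π C, hv, map_zero]
    obtain ⟨w, c, h⟩ := hcyc _ h1
    refine ⟨res deg (i + 2) w, ?_⟩
    have h2 := congrArg (res deg (i + 1)) h
    rw [res_inc, map_add, res_dR π C] at h2
    rw [h2]
    have h3 : res deg (i + 1) (Finsupp.single o (algebraMap k R c)) = 0 := by
      ext ⟨e, he⟩
      rw [res_apply, Finsupp.single_apply, if_neg]
      · rfl
      · rintro rfl
        rw [(C.deg0 o).2 rfl] at he
        omega
    rw [h3, add_zero]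
  · intro v hv
    have h1 : dR π b d (inc deg 0 v) = 0 := by
      ext e
      by_contra he
      have := dR_gr π C _ 0 (inc_supp 0 v) e he
      omega
    obtain ⟨w, c, h⟩ := hcyc _ h1
    refine ⟨res deg 1 w, ?_⟩
    have h2 := congrArg (res deg 0) h
    rw [res_inc, map_add, res_dR π C] at h2
    have h3 : c = 0 := by
      have := congrArg (fun u => ε (u default)) h2
      simp only [Finsupp.add_apply, map_add, hmin, hv, zero_add] at this
      have h4 : res deg 0 (Finsupp.single o (algebraMap k R c)) default = algebraMap k R c := by
        change (Finsupp.single o (algebraMap k R c) : ι →₀ R) o = _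
        simp
      rw [h4] at this
      simpa using this.symm
    rw [h2, h3]
    simp

end RedPart

section Final

variable {k : Type} [Field k] {n : ℕ}

/-- existence of a divided power stage -/
def DStage (q : Fin n → Fin n → kˣ) (aug : SkewPoly k q →ₐ[k] k) (I : Ideal (SkewPoly k q))
    (j : ℕ) : Prop :=
  ∃ (ι F : Type) (_ : AddCommGroup F) (_ : Module (SkewPoly k q) F) (_ : Module k F)
    (_ : IsScalarTower k (SkewPoly k q) F) (b : Module.Basis ι (SkewPoly k q) F) (deg : ι → ℕ)
    (d : Module.End (SkewPoly k q) F)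
    (ρ η : Fin n → Module.End (SkewPoly k q) F) (χ : ι → Fin n → kˣ) (o : ι),
    Cx aug (fun _ => True) b deg d ρ η χ o ∧ IEx I b d o ∧
    (∀ i, Finite {e : ι // deg e = i}) ∧
    ser deg * (1 - PowerSeries.X ^ 2) ^ j = (1 + PowerSeries.X) ^ n

lemma DStage_zero (q : Fin n → Fin n → kˣ) (aug : SkewPoly k q →ₐ[k] k)
    (hq1 : ∀ i, q i i = 1) (hq2 : ∀ i j, q i j = (q j i)⁻¹)
    (haug : ∀ i, aug (skewVar k q i) = 0) : DStage q aug ⊥ 0 := by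
  obtain ⟨ι, F, _, _, _, _, b, deg, d, ρ, η, χ, o, C, E, hf, hs⟩ :=
    KStage_all q aug hq1 hq2 haug n le_rfl
  have hJ : (fun i : Fin n => i.val < n) = fun _ => True := by funext i; simp
  have hbot : ∀ v : F, v ∈ IF b ⊥ ↔ v = 0 := by
    intro v
    rw [mem_IF]
    constructor
    · intro h
      apply b.repr.injective
      ext e
      simpa using h e
    · rintro rfl; simp
  refine ⟨ι, F, _, _, _, _, b, deg, d, ρ, η, χ, o, hJ ▸ C, ⟨fun v => ?_, fun v hv => ?_⟩, hf, ?_⟩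
  · rw [hbot, E.d2]
  · rw [hbot] at hv
    obtain ⟨w, r, rfl⟩ := E.ex v hv
    obtain ⟨w', hw'⟩ := C.LL_bdry n (fun i hi => hi) _ (sub_aug_mem q aug haug r)
    refine ⟨w + w', aug r, ?_⟩
    rw [hbot, map_add, hw', sub_smul, algebraMap_smul]
    abel
  · rw [hs]; simp

lemma DStage_succ (q : Fin n → Fin n → kˣ) (aug : SkewPoly k q →ₐ[k] k)
    (hq1 : ∀ i, q i i = 1) (hq2 : ∀ i j, q i j = (q j i)⁻¹)
    (haug : ∀ i, aug (skewVar k q i) = 0) {I I' : Ideal (SkewPoly k q)} [I.IsTwoSided]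
    [I'.IsTwoSided] {D : ℕ} (hD : 2 ≤ D) {w0 : List (Fin n)}
    {f : SkewPoly k q} (hfw : f ∈ CW q D w0) (hI : I ≤ I') (hf : f ∈ I')
    (hI' : ∀ a ∈ I', ∃ r, a - r * f ∈ I) (hm : ∀ a ∈ I, aug a = 0)
    (hreg : ∀ a, a * f ∈ I → a ∈ I) (j : ℕ) (S : DStage q aug I j) : DStage q aug I' (j + 1) := by
  obtain ⟨ι, F, _, _, _, _, b, deg, d, ρ, η, χ, o, C, E, hfin, hs⟩ := S
  obtain ⟨s, h1, h2, h3⟩ := C.exists_s hD hfw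
  refine ⟨Σ _ : ℕ, ι, ℕ →₀ F, inferInstance, inferInstance, inferInstance, inferInstance,
    Finsupp.basis fun _ => b, ddeg deg, dd d s, dt w0 ρ, dt w0 η, dχ q w0 χ, ⟨0, o⟩,
    div_step hq2 haug C hD h1,
    div_ex C (β := fun e => (w0.map (χ e)).prod) hI hf hI' hm hreg E (C.rels.ZZ_sq hq1 hq2 h1) h2 h3,
    dser_fin deg hfin, ?_⟩
  rw [pow_succ', ← mul_assoc, dser deg hfin, hs]

theorem final 
    (q : Fin n → Fin n → kˣ)
    (hq1 : ∀ i : Fin n, q i i = 1)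
    (hq2 : ∀ i j : Fin n, q i j = (q j i)⁻¹)
    {c : ℕ} (f : Fin c → SkewPoly k q)
    (deg : Fin c → ℕ) (hdeg : ∀ i, 2 ≤ deg i)
    (hhom : ∀ i : Fin c, f i ∈ wordSpan k q (deg i))
    (hnorm₁ : ∀ (i : Fin c) (a : SkewPoly k q), ∃ b, f i * a = b * f i)
    (hreg : ∀ (i : Fin c) (g : SkewPoly k q),
      f i * g ∈ Ideal.span {y | ∃ j : Fin c, j < i ∧ y = f j} →
      g ∈ Ideal.span {y | ∃ j : Fin c, j < i ∧ y = f j})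
    {R : Type} [Ring R] [Algebra k R]
    (π : SkewPoly k q →ₐ[k] R) (hπ : Function.Surjective π)
    (hker : RingHom.ker (π : SkewPoly k q →+* R) = Ideal.span (Set.range f))
    (ε : R →ₐ[k] k) (hε : ∀ i : Fin n, ε (π (skewVar k q i)) = 0) :
    (PowerSeries.mk (fun i : ℕ =>
        (Module.finrank k
          (((Ext k (ModuleCat R) i).obj
              (Opposite.op (ModuleCat.of R (R ⧸ RingHom.ker (ε : R →+* k))))).obj
            (ModuleCat.of R (R ⧸ RingHom.ker (ε : R →+* k)))) : ℤ)) : PowerSeries ℤ) *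
      (1 - PowerSeries.X ^ 2) ^ c = (1 + PowerSeries.X) ^ n := by
  let S : ℕ → Set (SkewPoly k q) := fun j => {y | ∃ i : Fin c, i.val < j ∧ y = f i}
  have hsub : ∀ j, Ideal.span (S j) ≤ RingHom.ker (π : SkewPoly k q →+* R) := by
    intro j
    rw [hker]
    refine Ideal.span_mono ?_
    rintro _ ⟨i, _, rfl⟩
    exact ⟨i, rfl⟩
  have hm : ∀ j, ∀ a ∈ Ideal.span (S j), (ε.comp π) a = 0 := by
    intro j a ha
    have : π a = 0 := hsub j ha
    simp [this]
  have htwo : ∀ j, (Ideal.span (S j)).IsTwoSided := by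
    intro j
    refine ⟨fun {a} x ha => ?_⟩
    induction ha using Submodule.span_induction with
    | mem y h =>
      obtain ⟨i, hi, rfl⟩ := h
      obtain ⟨b', hb⟩ := hnorm₁ i x
      rw [hb]
      exact Ideal.mul_mem_left _ _ (Ideal.subset_span ⟨i, hi, rfl⟩)
    | zero => simp
    | add y z _ _ hy hz => rw [add_mul]; exact add_mem hy hz
    | smul r y _ hy => rw [smul_eq_mul, mul_assoc]; exact Ideal.mul_mem_left _ _ hy
  have hf0 : ∀ i, f i ≠ 0 := by
    intro i h0
    have h1 : (1 : SkewPoly k q) ∈ Ideal.span (S i.val) := hreg i 1 (by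
      rw [h0, zero_mul]; exact zero_mem _)
    have := hm _ _ h1
    simp at this
  have hcw : ∀ i, ∃ w0, f i ∈ CW q (deg i) w0 := fun i =>
    normal_CW q hq1 hq2 (hhom i) (hf0 i) (fun l => hnorm₁ i _)
  have stages : ∀ j, j ≤ c → DStage q (ε.comp π) (Ideal.span (S j)) j := by
    intro j
    induction j with
    | zero =>
      intro _
      have : S 0 = ∅ := by
        ext y; simp [S]
      rw [this, Ideal.span_empty]
      exact DStage_zero q _ hq1 hq2 hε
    | succ j ih =>
      intro hj
      obtain ⟨w0, hw0⟩ := hcw ⟨j, hj⟩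
      have := htwo j
      have := htwo (j + 1)
      have hS : S (j + 1) = insert (f ⟨j, hj⟩) (S j) := by
        ext y
        constructor
        · rintro ⟨i, hi, rfl⟩
          rcases Nat.lt_or_ge i.val j with h | h
          · exact Or.inr ⟨i, h, rfl⟩
          · left
            congr 1
            exact Fin.ext (by simp; omega)
        · rintro (rfl | ⟨i, hi, rfl⟩)
          · exact ⟨⟨j, hj⟩, by simp, rfl⟩
          · exact ⟨i, by omega, rfl⟩
      have hle : Ideal.span (S j) ≤ Ideal.span (S (j + 1)) := by
        refine Ideal.span_mono ?_
        rintro _ ⟨i, hi, rfl⟩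
        exact ⟨i, by omega, rfl⟩
      have hfm : f ⟨j, hj⟩ ∈ Ideal.span (S (j + 1)) := by
        rw [hS]
        exact Ideal.subset_span (Set.mem_insert _ _)
      refine DStage_succ (I := Ideal.span (S j)) (I' := Ideal.span (S (j + 1))) q (ε.comp π)
        hq1 hq2 hε (hdeg ⟨j, hj⟩) hw0 hle hfm ?_ (hm j) ?_ j (ih (by omega))
      · intro a ha
        rw [hS, Ideal.mem_span_insert] at ha
        obtain ⟨r, z, hz, rfl⟩ := ha
        exact ⟨r, by simpa using hz⟩
      · intro a ha
        refine reg_right q hq2 hw0 (S j) ?_ (hreg ⟨j, hj⟩) a ha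
        rintro _ ⟨i, _, rfl⟩
        exact ⟨_, hcw i⟩
  obtain ⟨ι, F, _, _, _, _, b, dg, d, ρ, η, χ, o, C, E, hfin, hs⟩ := stages c le_rfl
  have hSc : Ideal.span (S c) = RingHom.ker (π : SkewPoly k q →+* R) := by
    rw [hker]
    congr 1
    ext y
    constructor
    · rintro ⟨i, _, rfl⟩; exact ⟨i, rfl⟩
    · rintro ⟨i, rfl⟩; exact ⟨i, i.2, rfl⟩
  rw [hSc] at E
  rw [← hs, ser]
  congr 2
  funext i
  rw [ext_card π hπ ε C E hfin i]

end Final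
end SkewCI



/-- Let R = Q/(f₁,…,f_c) be a skew complete intersection, where Q is a skew
polynomial ring in n variables and f₁,…,f_c is a regular sequence of homogeneous normal
elements contained in (x₁,…,xₙ)².  Then the Poincaré series of k over R satisfies
(Σ_i dim_k Ext_R^i(k,k) tⁱ)·(1−t²)^c = (1+t)^n, i.e. P^R_k(t) = (1+t)^n/(1−t²)^c. -/
theorem poincare_series_of_skew_complete_intersection
    {k : Type} [Field k] {n : ℕ}
    (q : Fin n → Fin n → kˣ)
    (hq1 : ∀ i : Fin n, q i i = 1)
    (hq2 : ∀ i j : Fin n, q i j = (q j i)⁻¹)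
    {c : ℕ} (f : Fin c → SkewPoly k q)
    (deg : Fin c → ℕ) (hdeg : ∀ i, 2 ≤ deg i)
    -- each f i is homogeneous of internal degree ≥ 2 (hence lies in (x₁,…,xₙ)²):
    (hhom : ∀ i : Fin c, f i ∈ wordSpan k q (deg i))
    -- each f i is normal:
    (hnorm₁ : ∀ (i : Fin c) (a : SkewPoly k q), ∃ b, f i * a = b * f i)
    (hnorm₂ : ∀ (i : Fin c) (a : SkewPoly k q), ∃ b, a * f i = f i * b)
    -- f₁,…,f_c is a regular sequence:
    (hreg : ∀ (i : Fin c) (g : SkewPoly k q),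
      f i * g ∈ Ideal.span {y | ∃ j : Fin c, j < i ∧ y = f j} →
      g ∈ Ideal.span {y | ∃ j : Fin c, j < i ∧ y = f j})
    -- R = Q/(f₁,…,f_c):
    {R : Type} [Ring R] [Algebra k R]
    (π : SkewPoly k q →ₐ[k] R) (hπ : Function.Surjective π)
    (hker : RingHom.ker (π : SkewPoly k q →+* R) = Ideal.span (Set.range f))
    -- the augmentation R → k, giving k its (right) R-module structure k = R/R₊:
    (ε : R →ₐ[k] k) (hε : ∀ i : Fin n, ε (π (skewVar k q i)) = 0) :
    -- conclusion: P^R_k(t)·(1−t²)^c = (1+t)^n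
    (PowerSeries.mk (fun i : ℕ =>
        (Module.finrank k
          (((Ext k (ModuleCat R) i).obj
              (Opposite.op (ModuleCat.of R (R ⧸ RingHom.ker (ε : R →+* k))))).obj
            (ModuleCat.of R (R ⧸ RingHom.ker (ε : R →+* k)))) : ℤ)) : PowerSeries ℤ) *
      (1 - PowerSeries.X ^ 2) ^ c = (1 + PowerSeries.X) ^ n := by
  exact SkewCI.final q hq1 hq2 f deg hdeg hhom hnorm₁ hreg π hπ hker ε hε
end
end
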